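/- arXiv:1105.5490 — 2 statements merged into one kernel-verified Lean document; each statement's English description precedes it below -/
import Mathlib

section
/- There is an integer N such that for each integer k ≥ N the set of connected k-regular finite simple graphs G with λmin(G) < −1−√2 is nonempty; letting ξ̂_k be the supremum of λmin(G) over this set, the limit of ξ̂_k as k → ∞ equals α₁, the smallest real root of the polynomial x³ + 2x² − 2x − 2. -/
open SimpleGraph Filter

attribute [local instance] Classical.propDecidable

lemma adjMatrix_isHermitian {V : Type} [Fintype V] [DecidableEq V] (G : SimpleGraph V)
    [DecidableRel G.Adj] : (G.adjMatrix ℝ).IsHermitian := by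
  rw [Matrix.IsHermitian, Matrix.conjTranspose_eq_transpose_of_trivial]
  exact G.isSymm_adjMatrix

/-- The smallest eigenvalue of the (real) adjacency matrix of a finite simple graph. -/
noncomputable def lambdaMin {V : Type} [Fintype V] (G : SimpleGraph V) : ℝ :=
  ⨅ i : V, (adjMatrix_isHermitian G).eigenvalues i

section LambdaMin

variable {V W : Type} [Fintype V] [Fintype W]

lemma le_lambdaMin_of_forall [Nonempty V] {G : SimpleGraph V} {c : ℝ}
    (h : ∀ a : V → ℝ, c * ∑ v, a v ^ 2 ≤ ∑ v, ∑ w, a v * a w * G.adjMatrix ℝ v w) :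
    c ≤ lambdaMin G := by
  refine le_ciInf fun i => ?_
  have hA := adjMatrix_isHermitian G
  have h1 := hA.mulVec_eigenvectorBasis i
  set u : V → ℝ := (hA.eigenvectorBasis i).ofLp with hu
  have h2 : ∑ v, u v ^ 2 = 1 := by
    have := hA.eigenvectorBasis.orthonormal.1 i
    rw [EuclideanSpace.norm_eq, Real.sqrt_eq_one] at this
    simpa using this
  have h3 := h u
  have h4 : ∑ v, ∑ w, u v * u w * G.adjMatrix ℝ v w = hA.eigenvalues i * ∑ v, u v ^ 2 := by
    rw [Finset.mul_sum]
    refine Finset.sum_congr rfl fun v _ => ?_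
    have := congrFun h1 v
    simp only [Matrix.mulVec, dotProduct, Pi.smul_apply, smul_eq_mul] at this
    calc _ = u v * ∑ w, G.adjMatrix ℝ v w * u w := by
          rw [Finset.mul_sum]; exact Finset.sum_congr rfl fun w _ => by ring
      _ = _ := by rw [this]; ring
  rw [h4, h2] at h3
  simpa using h3

lemma posSemidef_adjMatrix_sub {G : SimpleGraph V} {c : ℝ} (h : c ≤ lambdaMin G) :
    (G.adjMatrix ℝ - algebraMap ℝ (Matrix V V ℝ) c).PosSemidef := by
  have hA := adjMatrix_isHermitian G
  have hB : (G.adjMatrix ℝ - algebraMap ℝ (Matrix V V ℝ) c).IsHermitian := by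
    refine hA.sub ?_
    rw [Matrix.algebraMap_eq_diagonal]
    exact Matrix.isHermitian_diagonal _
  rw [hB.posSemidef_iff_eigenvalues_nonneg]
  intro i
  have h1 := hB.eigenvalues_mem_spectrum_real i
  rw [← spectrum.sub_singleton_eq, hA.spectrum_real_eq_range_eigenvalues] at h1
  obtain ⟨_, ⟨j, rfl⟩, _, rfl, h2⟩ := h1
  have h3 : lambdaMin G ≤ hA.eigenvalues j := ciInf_le (Set.finite_range _).bddBelow j
  simp only [Pi.zero_apply]
  simp only at h2
  linarith

lemma form_sub_algebraMap (M : Matrix V V ℝ) (c : ℝ) (a : V → ℝ) :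
    star a ⬝ᵥ (M - algebraMap ℝ (Matrix V V ℝ) c).mulVec a =
      ∑ v, ∑ w, a v * a w * M v w - c * ∑ v, a v ^ 2 := by
  simp only [Matrix.sub_mulVec, dotProduct_sub]
  congr 1
  · simp only [dotProduct, Matrix.mulVec, star_trivial, Finset.mul_sum]
    exact Finset.sum_congr rfl fun v _ => Finset.sum_congr rfl fun w _ => by ring
  · rw [Matrix.algebraMap_eq_diagonal]
    simp only [dotProduct, Matrix.mulVec_diagonal, Finset.mul_sum]
    exact Finset.sum_congr rfl fun v _ => by simp; ring

lemma lambdaMin_mul_le (G : SimpleGraph V) (a : V → ℝ) :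
    lambdaMin G * ∑ v, a v ^ 2 ≤ ∑ v, ∑ w, a v * a w * G.adjMatrix ℝ v w := by
  have h := (Matrix.posSemidef_iff_dotProduct_mulVec.1
    (posSemidef_adjMatrix_sub (le_refl (lambdaMin G)))).2 a
  rw [form_sub_algebraMap] at h
  linarith

lemma lambdaMin_le_lambdaMin_of_iso [Nonempty W] {G : SimpleGraph V} {H : SimpleGraph W}
    (e : G ≃g H) : lambdaMin G ≤ lambdaMin H := by
  refine le_lambdaMin_of_forall fun a => ?_
  have h := lambdaMin_mul_le G fun v => a (e v)
  have h1 : ∑ v, a (e v) ^ 2 = ∑ w, a w ^ 2 := e.toEquiv.sum_comp fun w => a w ^ 2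
  have h2 : ∑ v, ∑ w, a (e v) * a (e w) * G.adjMatrix ℝ v w =
      ∑ v, ∑ w, a v * a w * H.adjMatrix ℝ v w := by
    rw [← e.toEquiv.sum_comp]
    refine Finset.sum_congr rfl fun v _ => ?_
    rw [← e.toEquiv.sum_comp]
    refine Finset.sum_congr rfl fun w _ => ?_
    simp [adjMatrix_apply, e.map_adj_iff]
  rwa [h1, h2] at h

lemma lambdaMin_eq_of_iso [Nonempty V] {G : SimpleGraph V} {H : SimpleGraph W}
    (e : G ≃g H) : lambdaMin G = lambdaMin H :=
  haveI : Nonempty W := ⟨e (Classical.arbitrary V)⟩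
  le_antisymm (lambdaMin_le_lambdaMin_of_iso e) (lambdaMin_le_lambdaMin_of_iso e.symm)

lemma exists_gram_of_le_lambdaMin {G : SimpleGraph V} {t : ℝ} (h : -t ≤ lambdaMin G) :
    ∃ (m : ℕ) (x : V → EuclideanSpace ℝ (Fin m)), ∀ v w,
      inner ℝ (x v) (x w) = if v = w then t else if G.Adj v w then 1 else 0 := by
  obtain ⟨m, y, hy⟩ := Matrix.posSemidef_iff_eq_sum_vecMulVec.1 (posSemidef_adjMatrix_sub h)
  refine ⟨m, fun v => WithLp.toLp 2 fun i => y i v, fun v w => ?_⟩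
  have h1 := congrFun (congrFun hy v) w
  rw [Matrix.sum_apply] at h1
  simp only [Matrix.vecMulVec_apply, star_trivial] at h1
  have h2 : inner ℝ (WithLp.toLp 2 fun i => y i v : EuclideanSpace ℝ (Fin m))
      (WithLp.toLp 2 fun i => y i w) = ∑ i, y i v * y i w := by
    simp [PiLp.inner_apply, mul_comm]
  rw [h2, ← h1, Matrix.algebraMap_eq_diagonal]
  by_cases hvw : v = w
  · subst hvw; simp [adjMatrix_apply]
  · simp [adjMatrix_apply, hvw]

end LambdaMin

section LocalStructure

/-- A symmetric matrix `S` with diagonal entries in `{-1, -2}` and integer off-diagonal entries,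
such that every principal submatrix of `S + t I` of size at most `4` is positive semidefinite. -/
structure IsLocallyBounded {V : Type} (S : V → V → ℝ) (t : ℝ) : Prop where
  symm : ∀ i j, S i j = S j i
  int : ∀ i j, i ≠ j → ∃ z : ℤ, S i j = z
  diag : ∀ i, S i i = -1 ∨ S i i = -2
  form_nonneg : ∀ s : Finset V, s.card ≤ 4 → ∀ a : V → ℝ,
    0 ≤ ∑ i ∈ s, ∑ j ∈ s, a i * a j * S i j + t * ∑ i ∈ s, a i ^ 2

namespace IsLocallyBounded

variable {V : Type} {S : V → V → ℝ} {t : ℝ} (h : IsLocallyBounded S t)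
include h

lemma form_pair {i j : V} (hij : i ≠ j) (a b : ℝ) :
    0 ≤ (t + S i i) * a ^ 2 + (t + S j j) * b ^ 2 + 2 * a * b * S i j := by
  have := h.form_nonneg {i, j} ((Finset.card_le_two).trans (by norm_num))
    (fun v => if v = i then a else b)
  rw [Finset.sum_pair hij, Finset.sum_pair hij, Finset.sum_pair hij, Finset.sum_pair hij] at this
  simp only [if_true, hij.symm, if_false] at this
  rw [h.symm j i] at this
  linarith

lemma form_triple {i j k : V} (hij : i ≠ j) (hik : i ≠ k) (hjk : j ≠ k) (a b c : ℝ) :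
    0 ≤ (t + S i i) * a ^ 2 + (t + S j j) * b ^ 2 + (t + S k k) * c ^ 2
      + 2 * a * b * S i j + 2 * a * c * S i k + 2 * b * c * S j k := by
  have := h.form_nonneg {i, j, k} (Finset.card_le_three.trans (by norm_num))
    (fun v => if v = i then a else if v = j then b else c)
  have e : ∀ f : V → ℝ, ∑ v ∈ {i, j, k}, f v = f i + f j + f k := fun f => by
    rw [Finset.sum_insert (by simp [hij, hik]), Finset.sum_pair hjk, add_assoc]
  simp only [e, if_true, hij.symm, hik.symm, hjk.symm, if_false] at this
  rw [h.symm j i, h.symm k i, h.symm k j] at this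
  linarith

lemma form_quadruple {i j k l : V} (hij : i ≠ j) (hik : i ≠ k) (hil : i ≠ l) (hjk : j ≠ k)
    (hjl : j ≠ l) (hkl : k ≠ l) (a b c d : ℝ) :
    0 ≤ (t + S i i) * a ^ 2 + (t + S j j) * b ^ 2 + (t + S k k) * c ^ 2 + (t + S l l) * d ^ 2
      + 2 * a * b * S i j + 2 * a * c * S i k + 2 * a * d * S i l
      + 2 * b * c * S j k + 2 * b * d * S j l + 2 * c * d * S k l := by
  have := h.form_nonneg {i, j, k, l} Finset.card_le_four
    (fun v => if v = i then a else if v = j then b else if v = k then c else d)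
  have e : ∀ f : V → ℝ, ∑ v ∈ {i, j, k, l}, f v = f i + f j + f k + f l := fun f => by
    rw [Finset.sum_insert (by simp [hij, hik, hil]), Finset.sum_insert (by simp [hjk, hjl]),
      Finset.sum_pair hkl]
    ring
  simp only [e, if_true, hij.symm, hik.symm, hjk.symm, hil.symm, hjl.symm, hkl.symm,
    if_false] at this
  rw [h.symm j i, h.symm k i, h.symm k j, h.symm l i, h.symm l j, h.symm l k] at this
  linarith

variable {μ : ℝ} (hμ : μ ^ 3 + μ ^ 2 - 3 * μ - 1 = 0) (hμ0 : 0 < μ) (hμ1 : μ ≤ 3 / 2)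
  (ht : t < μ + 1)

lemma eq_zero_of_abs_lt_one {i j : V} (hij : i ≠ j) (h1 : S i j < 1) (h2 : -1 < S i j) :
    S i j = 0 := by
  obtain ⟨z, hz⟩ := h.int i j hij
  rw [hz] at h1 h2 ⊢
  have h1' : z < 1 := by exact_mod_cast h1
  have h2' : -1 < z := by exact_mod_cast h2
  have : z = 0 := by omega
  simp [this]

include hμ1 ht

lemma eq_zero_of_diag_eq_neg_two {i j : V} (hij : i ≠ j) (hi : S i i = -2) : S i j = 0 := by
  have h1 := h.form_pair hij 2 1
  have h2 := h.form_pair hij 2 (-1)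
  rcases h.diag j with hj | hj <;> rw [hi, hj] at h1 h2 <;>
    exact h.eq_zero_of_abs_lt_one hij (by linarith) (by linarith)

lemma eq_one_or_eq_neg_one {i j : V} (hij : i ≠ j) (hS : S i j ≠ 0) :
    S i j = 1 ∨ S i j = -1 := by
  have hi : S i i = -1 := (h.diag i).resolve_right fun hi =>
    hS (h.eq_zero_of_diag_eq_neg_two hμ1 ht hij hi)
  have hj : S j j = -1 := (h.diag j).resolve_right fun hj =>
    hS (h.symm i j ▸ h.eq_zero_of_diag_eq_neg_two hμ1 ht hij.symm hj)
  have h1 := h.form_pair hij 1 1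
  have h2 := h.form_pair hij 1 (-1)
  rw [hi, hj] at h1 h2
  obtain ⟨z, hz⟩ := h.int i j hij
  rw [hz] at h1 h2 hS ⊢
  have h1' : z < 2 := by
    have : (z : ℝ) < 2 := by linarith
    exact_mod_cast this
  have h2' : -2 < z := by
    have : (-2 : ℝ) < z := by linarith
    exact_mod_cast this
  have h3 : z ≠ 0 := by exact_mod_cast hS
  have : z = 1 ∨ z = -1 := by omega
  rcases this with rfl | rfl <;> norm_num

lemma mul_self_eq_one {i j : V} (hij : i ≠ j) (hS : S i j ≠ 0) : S i j * S i j = 1 :=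
  mul_self_eq_one_iff.2 (h.eq_one_or_eq_neg_one hμ1 ht hij hS)

lemma diag_eq_neg_one {i j : V} (hij : i ≠ j) (hS : S i j ≠ 0) : S i i = -1 :=
  (h.diag i).resolve_right fun hi => hS (h.eq_zero_of_diag_eq_neg_two hμ1 ht hij hi)

lemma diag_eq_neg_one_right {i j : V} (hij : i ≠ j) (hS : S i j ≠ 0) : S j j = -1 :=
  h.diag_eq_neg_one hμ1 ht hij.symm (h.symm i j ▸ hS)

/-- Triangles are balanced. -/
lemma triangle {i j k : V} (hij : i ≠ j) (hik : i ≠ k) (hjk : j ≠ k) (h1 : S i j ≠ 0)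
    (h2 : S i k ≠ 0) (h3 : S j k ≠ 0) : S j k = S i j * S i k := by
  have q1 := h.eq_one_or_eq_neg_one hμ1 ht hij h1
  have q2 := h.eq_one_or_eq_neg_one hμ1 ht hik h2
  have q3 := h.eq_one_or_eq_neg_one hμ1 ht hjk h3
  have f := h.form_triple hij hik hjk 1 (-S i j) (-S i k)
  rw [h.diag_eq_neg_one hμ1 ht hij h1, h.diag_eq_neg_one_right hμ1 ht hij h1,
    h.diag_eq_neg_one_right hμ1 ht hik h2] at f
  generalize S i j = x at *
  generalize S i k = y at *
  generalize S j k = z at *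
  rcases q1 with rfl | rfl <;> rcases q2 with rfl | rfl <;> rcases q3 with rfl | rfl <;>
    norm_num at f ⊢ <;> linarith

/-- There is no induced diamond. -/
lemma not_diamond {i j k l : V} (hij : i ≠ j) (hik : i ≠ k) (hil : i ≠ l) (hjk : j ≠ k)
    (hjl : j ≠ l) (hkl : k ≠ l) (h1 : S i j ≠ 0) (h2 : S i k ≠ 0) (h3 : S i l ≠ 0)
    (h4 : S j k ≠ 0) (h5 : S j l ≠ 0) : S k l ≠ 0 := by
  intro h6
  have f := h.form_quadruple hij hik hil hjk hjl hkl 4 (4 * S i j) (-5 * S i k) (-5 * S i l)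
  rw [h6, h.triangle hμ1 ht hij hik hjk h1 h2 h4, h.triangle hμ1 ht hij hil hjl h1 h3 h5,
    h.diag_eq_neg_one hμ1 ht hij h1, h.diag_eq_neg_one_right hμ1 ht hij h1,
    h.diag_eq_neg_one_right hμ1 ht hik h2, h.diag_eq_neg_one_right hμ1 ht hil h3] at f
  have q1 := h.eq_one_or_eq_neg_one hμ1 ht hij h1
  have q2 := h.eq_one_or_eq_neg_one hμ1 ht hik h2
  have q3 := h.eq_one_or_eq_neg_one hμ1 ht hil h3
  generalize S i j = x at *
  generalize S i k = y at *
  generalize S i l = z at *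
  rcases q1 with rfl | rfl <;> rcases q2 with rfl | rfl <;> rcases q3 with rfl | rfl <;>
    linarith

/-- There is no induced claw. -/
lemma not_claw {i j k l : V} (hij : i ≠ j) (hik : i ≠ k) (hil : i ≠ l) (hjk : j ≠ k)
    (hjl : j ≠ l) (hkl : k ≠ l) (h1 : S i j ≠ 0) (h2 : S i k ≠ 0) (h3 : S i l ≠ 0)
    (h4 : S j k = 0) (h5 : S j l = 0) : S k l ≠ 0 := by
  intro h6
  have f := h.form_quadruple hij hik hil hjk hjl hkl 2 (-S i j) (-S i k) (-S i l)
  rw [h4, h5, h6,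
    h.diag_eq_neg_one hμ1 ht hij h1, h.diag_eq_neg_one_right hμ1 ht hij h1,
    h.diag_eq_neg_one_right hμ1 ht hik h2, h.diag_eq_neg_one_right hμ1 ht hil h3] at f
  have q1 := h.eq_one_or_eq_neg_one hμ1 ht hij h1
  have q2 := h.eq_one_or_eq_neg_one hμ1 ht hik h2
  have q3 := h.eq_one_or_eq_neg_one hμ1 ht hil h3
  generalize S i j = x at *
  generalize S i k = y at *
  generalize S i l = z at *
  rcases q1 with rfl | rfl <;> rcases q2 with rfl | rfl <;> rcases q3 with rfl | rfl <;>
    linarith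

/-- There is no induced path `l - j - i - k`. -/
lemma not_path {i j k l : V} (hij : i ≠ j) (hik : i ≠ k) (hil : i ≠ l) (hjk : j ≠ k)
    (hjl : j ≠ l) (hkl : k ≠ l) (h1 : S i j ≠ 0) (h2 : S i k ≠ 0) (h3 : S j l ≠ 0)
    (h4 : S j k = 0) (h5 : S i l = 0) : S k l ≠ 0 := by
  intro h6
  have f := h.form_quadruple hij hik hil hjk hjl hkl 3 (-3 * S i j) (-2 * S i k)
    (2 * S i j * S j l)
  rw [h4, h5, h6,
    h.diag_eq_neg_one hμ1 ht hij h1, h.diag_eq_neg_one_right hμ1 ht hij h1,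
    h.diag_eq_neg_one_right hμ1 ht hik h2, h.diag_eq_neg_one_right hμ1 ht hjl h3] at f
  have q1 := h.eq_one_or_eq_neg_one hμ1 ht hij h1
  have q2 := h.eq_one_or_eq_neg_one hμ1 ht hik h2
  have q3 := h.eq_one_or_eq_neg_one hμ1 ht hjl h3
  generalize S i j = x at *
  generalize S i k = y at *
  generalize S j l = z at *
  rcases q1 with rfl | rfl <;> rcases q2 with rfl | rfl <;> rcases q3 with rfl | rfl <;>
    linarith

/-- Induced four-cycles `i - j - l - k - i` are unbalanced. -/
lemma cycle {i j k l : V} (hij : i ≠ j) (hik : i ≠ k) (hil : i ≠ l) (hjk : j ≠ k)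
    (hjl : j ≠ l) (hkl : k ≠ l) (h1 : S i j ≠ 0) (h2 : S i k ≠ 0) (h3 : S j l ≠ 0)
    (h4 : S j k = 0) (h5 : S i l = 0) (h6 : S k l ≠ 0) :
    S i j * S j l + S i k * S k l = 0 := by
  have f := h.form_quadruple hij hik hil hjk hjl hkl 1 (-S i j) (-S i k)
    (S i j * S j l)
  rw [h4, h5,
    h.diag_eq_neg_one hμ1 ht hij h1, h.diag_eq_neg_one_right hμ1 ht hij h1,
    h.diag_eq_neg_one_right hμ1 ht hik h2, h.diag_eq_neg_one_right hμ1 ht hjl h3] at f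
  have q1 := h.eq_one_or_eq_neg_one hμ1 ht hij h1
  have q2 := h.eq_one_or_eq_neg_one hμ1 ht hik h2
  have q3 := h.eq_one_or_eq_neg_one hμ1 ht hjl h3
  have q4 := h.eq_one_or_eq_neg_one hμ1 ht hkl h6
  generalize S i j = x at *
  generalize S i k = y at *
  generalize S j l = z at *
  generalize S k l = w at *
  rcases q1 with rfl | rfl <;> rcases q2 with rfl | rfl <;> rcases q3 with rfl | rfl <;>
    rcases q4 with rfl | rfl <;> linarith

include hμ hμ0

/-- There is no induced paw. -/
lemma not_paw {i j k l : V} (hij : i ≠ j) (hik : i ≠ k) (hil : i ≠ l) (hjk : j ≠ k)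
    (hjl : j ≠ l) (hkl : k ≠ l) (h1 : S i j ≠ 0) (h2 : S i k ≠ 0) (h3 : S i l ≠ 0)
    (h4 : S j k ≠ 0) (h5 : S j l = 0) : S k l ≠ 0 := by
  intro h6
  have f := h.form_quadruple hij hik hil hjk hjl hkl (μ * (μ + 1)) (-μ * S i j) (-μ * S i k)
    (-(μ + 1) * S i l)
  rw [h5, h6, h.triangle hμ1 ht hij hik hjk h1 h2 h4,
    h.diag_eq_neg_one hμ1 ht hij h1, h.diag_eq_neg_one_right hμ1 ht hij h1,
    h.diag_eq_neg_one_right hμ1 ht hik h2, h.diag_eq_neg_one_right hμ1 ht hil h3] at f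
  have q1 := h.eq_one_or_eq_neg_one hμ1 ht hij h1
  have q2 := h.eq_one_or_eq_neg_one hμ1 ht hik h2
  have q3 := h.eq_one_or_eq_neg_one hμ1 ht hil h3
  generalize S i j = x at *
  generalize S i k = y at *
  generalize S i l = z at *
  have hgap : 0 < (μ + 1 - t) * ((μ * (μ + 1)) ^ 2 + 2 * μ ^ 2 + (μ + 1) ^ 2) :=
    mul_pos (by linarith) (by positivity)
  have hroot : (μ ^ 2 + μ) * (μ ^ 3 + μ ^ 2 - 3 * μ - 1) = 0 := by rw [hμ, mul_zero]
  rcases q1 with rfl | rfl <;> rcases q2 with rfl | rfl <;> rcases q3 with rfl | rfl <;>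
    linarith

lemma ne_zero_of_triangle {i j k l : V} (hij : i ≠ j) (hik : i ≠ k) (hil : i ≠ l) (hjk : j ≠ k)
    (hjl : j ≠ l) (h1 : S i j ≠ 0) (h2 : S i k ≠ 0) (h3 : S i l ≠ 0)
    (h4 : S j k ≠ 0) : S j l ≠ 0 := by
  intro h5
  rcases eq_or_ne k l with rfl | hkl
  · exact h4 h5
  by_cases h6 : S k l = 0
  · exact h.not_paw hμ hμ0 hμ1 ht hij hik hil hjk hjl hkl h1 h2 h3 h4 h5 h6
  · exact h.not_diamond hμ1 ht hik hij hil hjk.symm hkl hjl h2 h1 h3 (h.symm j k ▸ h4) h6 h5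

/-- A vertex with two nonadjacent neighbours has no further neighbour. -/
lemma eq_zero_of_nonadj {i j k l : V} (hij : i ≠ j) (hik : i ≠ k) (hil : i ≠ l) (hjk : j ≠ k)
    (hjl : j ≠ l) (hkl : k ≠ l) (h1 : S i j ≠ 0) (h2 : S i k ≠ 0)
    (h4 : S j k = 0) : S i l = 0 := by
  by_contra h3
  by_cases h5 : S j l = 0
  · by_cases h6 : S k l = 0
    · exact h.not_claw hμ1 ht hij hik hil hjk hjl hkl h1 h2 h3 h4 h5 h6
    · exact h.ne_zero_of_triangle hμ hμ0 hμ1 ht hik hil hij hkl hjk.symm h2 h3 h1 h6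
        (h.symm j k ▸ h4)
  · exact h.ne_zero_of_triangle hμ hμ0 hμ1 ht hij hil hik hjl hjk h1 h3 h2 h5 h4

variable [Fintype V]

/-- An eigenvector for an eigenvalue less than `-1 - √2` vanishes at the vertices of a triangle. -/
lemma eigenvector_eq_zero_of_triangle {a : V → ℝ} {r : ℝ} (hr : r < -2)
    (ha : ∀ i, ∑ j, S i j * a j = r * a i) {i j k : V} (hij : i ≠ j) (hik : i ≠ k)
    (hjk : j ≠ k) (h1 : S i j ≠ 0) (h2 : S i k ≠ 0) (h4 : S j k ≠ 0) : a i = 0 := by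
  set K : Finset V := Finset.univ.filter fun l => l = i ∨ S i l ≠ 0 with hK
  set s : V → ℝ := fun l => if l = i then 1 else S i l with hs
  have hcl : ∀ l, l ≠ i → S i l ≠ 0 → ∀ m, m ≠ l → S l m ≠ 0 → m = i ∨ S i m ≠ 0 := by
    intro l hli hl m hml hm
    by_contra! hc
    obtain ⟨p, hpi, hpl, hp, hlp⟩ : ∃ p, p ≠ i ∧ p ≠ l ∧ S i p ≠ 0 ∧ S l p ≠ 0 := by
      rcases eq_or_ne l j with rfl | hlj
      · exact ⟨k, hik.symm, hjk.symm, h2, h4⟩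
      · exact ⟨j, hij.symm, hlj.symm, h1, h.symm j l ▸
          h.ne_zero_of_triangle hμ hμ0 hμ1 ht hij hik hli.symm hjk hlj.symm h1 h2 hl h4⟩
    exact h.ne_zero_of_triangle hμ hμ0 hμ1 ht hli hpl.symm hml.symm hpi.symm hc.1.symm
      (h.symm i l ▸ hl) hlp hm hp hc.2
  have hcl' : ∀ l, l ≠ i → S i l ≠ 0 → ∀ m, m ≠ l → m ≠ i → S i m ≠ 0 → S l m ≠ 0 := by
    intro l hli hl m hml hmi hm
    obtain ⟨p, hpi, hpl, hp, hlp⟩ : ∃ p, p ≠ i ∧ p ≠ l ∧ S i p ≠ 0 ∧ S l p ≠ 0 := by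
      rcases eq_or_ne l j with rfl | hlj
      · exact ⟨k, hik.symm, hjk.symm, h2, h4⟩
      · exact ⟨j, hij.symm, hlj.symm, h1, h.symm j l ▸
          h.ne_zero_of_triangle hμ hμ0 hμ1 ht hij hik hli.symm hjk hlj.symm h1 h2 hl h4⟩
    exact h.ne_zero_of_triangle hμ hμ0 hμ1 ht hli.symm hpi.symm hmi.symm hpl.symm hml.symm
      hl hp hm hlp
  have hss : ∀ l ∈ K, s l * s l = 1 := by
    intro l hl
    by_cases hli : l = i
    · simp [hs, hli]
    · have : S i l ≠ 0 := by simpa [hK, hli] using hl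
      simpa [hs, hli] using h.mul_self_eq_one hμ1 ht (Ne.symm hli) this
  have hrow : ∀ l ∈ K, s l * ∑ m ∈ K, s m * a m = (r + 2) * a l := by
    intro l hl
    have hsum : ∑ m, S l m * a m = ∑ m ∈ K, S l m * a m := by
      symm
      refine Finset.sum_subset (Finset.subset_univ _) fun m _ hm => ?_
      have hm' : m ≠ i ∧ S i m = 0 := by simpa [hK] using hm
      have : S l m = 0 := by
        by_contra hlm
        by_cases hli : l = i
        · exact hlm (hli ▸ hm'.2)
        · have hl' : S i l ≠ 0 := by simpa [hK, hli] using hl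
          rcases eq_or_ne m l with rfl | hml
          · exact hl' hm'.2
          · rcases hcl l hli hl' m hml hlm with h' | h'
            · exact hm'.1 h'
            · exact h' hm'.2
      rw [this, zero_mul]
    have hent : ∀ m ∈ K, S l m * a m = s l * (s m * a m) - if l = m then 2 * a m else 0 := by
      intro m hm
      by_cases hlm : l = m
      · subst hlm
        have hd : S l l = -1 := by
          by_cases hli : l = i
          · exact hli ▸ h.diag_eq_neg_one hμ1 ht hij h1
          · exact h.diag_eq_neg_one_right hμ1 ht (Ne.symm hli) (by simpa [hK, hli] using hl)
        rw [hd, if_pos rfl, ← mul_assoc, hss l hl]; ring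
      · rw [if_neg hlm, sub_zero, ← mul_assoc]
        congr 1
        by_cases hli : l = i
        · subst hli
          simp [hs, Ne.symm hlm]
        · have hl' : S i l ≠ 0 := by simpa [hK, hli] using hl
          by_cases hmi : m = i
          · subst hmi
            simp [hs, hli, h.symm l m]
          · have hm' : S i m ≠ 0 := by simpa [hK, hmi] using hm
            simp only [hs, hli, hmi, if_false]
            exact h.triangle hμ1 ht (Ne.symm hli) (Ne.symm hmi) hlm hl' hm'
              (hcl' l hli hl' m (Ne.symm hlm) hmi hm')
    have := ha l
    rw [hsum, Finset.sum_congr rfl hent, Finset.sum_sub_distrib, ← Finset.mul_sum,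
      Finset.sum_ite_eq, if_pos hl] at this
    linarith
  have htot : (K.card : ℝ) * ∑ m ∈ K, s m * a m = (r + 2) * ∑ m ∈ K, s m * a m := by
    rw [Finset.mul_sum (a := r + 2), ← nsmul_eq_mul, ← Finset.sum_const]
    refine Finset.sum_congr rfl fun l hl => ?_
    calc _ = s l * s l * ∑ m ∈ K, s m * a m := by rw [hss l hl, one_mul]
      _ = s l * ((r + 2) * a l) := by rw [mul_assoc, hrow l hl]
      _ = _ := by ring
  have hzero : ∑ m ∈ K, s m * a m = 0 := by
    have : ((K.card : ℝ) - (r + 2)) * ∑ m ∈ K, s m * a m = 0 := by rw [sub_mul, htot, sub_self]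
    refine (mul_eq_zero.1 this).resolve_left ?_
    have : (0 : ℝ) ≤ K.card := Nat.cast_nonneg _
    linarith
  have hi := hrow i (by simp [hK])
  rw [hzero, mul_zero] at hi
  exact (mul_eq_zero.1 hi.symm).resolve_left (by linarith)

omit [Fintype V] in
lemma eq_zero_of_cherry_of_ne {i j k l : V} (hij : i ≠ j) (hik : i ≠ k) (hil : i ≠ l)
    (hjk : j ≠ k) (hjl : j ≠ l) (h1 : S i j ≠ 0) (h2 : S i k ≠ 0) (h4 : S j k = 0)
    (h3 : S j l ≠ 0) : k ≠ l ∧ S i l = 0 ∧ S k l ≠ 0 := by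
  have hkl : k ≠ l := by rintro rfl; exact h3 h4
  have hil0 := h.eq_zero_of_nonadj hμ hμ0 hμ1 ht hij hik hil hjk hjl hkl h1 h2 h4
  exact ⟨hkl, hil0, h.not_path hμ1 ht hij hik hil hjk hjl hkl h1 h2 h3 h4 hil0⟩

/-- An eigenvector for an eigenvalue less than `-1 - √2` vanishes at every vertex with two
nonadjacent neighbours. -/
lemma eigenvector_eq_zero_of_cherry {a : V → ℝ} {r : ℝ} (hr : r < -1 - Real.sqrt 2)
    (ha : ∀ i, ∑ j, S i j * a j = r * a i) {i j k : V} (hij : i ≠ j) (hik : i ≠ k)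
    (hjk : j ≠ k) (h1 : S i j ≠ 0) (h2 : S i k ≠ 0) (h4 : S j k = 0) : a i = 0 := by
  have q1 := h.mul_self_eq_one hμ1 ht hij h1
  have q2 := h.mul_self_eq_one hμ1 ht hik h2
  have hsq : (r + 1) ^ 2 - 2 ≠ 0 := by
    have h0 : 0 ≤ Real.sqrt 2 := Real.sqrt_nonneg 2
    have h2 : Real.sqrt 2 ^ 2 = 2 := Real.sq_sqrt (by norm_num)
    nlinarith
  have di := h.diag_eq_neg_one hμ1 ht hij h1
  have dj := h.diag_eq_neg_one_right hμ1 ht hij h1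
  have dk := h.diag_eq_neg_one_right hμ1 ht hik h2
  have h1' : S j i ≠ 0 := h.symm i j ▸ h1
  have h2' : S k i ≠ 0 := h.symm i k ▸ h2
  have hi : (r + 1) * a i = S i j * a j + S i k * a k := by
    have hsum : ∑ m, S i m * a m = ∑ m ∈ {i, j, k}, S i m * a m := by
      symm
      refine Finset.sum_subset (Finset.subset_univ _) fun m _ hm => ?_
      simp only [Finset.mem_insert, Finset.mem_singleton, not_or] at hm
      rw [h.eq_zero_of_nonadj hμ hμ0 hμ1 ht hij hik (Ne.symm hm.1) hjk (Ne.symm hm.2.1)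
        (Ne.symm hm.2.2) h1 h2 h4, zero_mul]
    have := ha i
    rw [hsum, Finset.sum_insert (by simp [hij, hik]), Finset.sum_pair hjk, di] at this
    linarith
  suffices hmain : ∃ b c d : ℝ, (r + 1) * a j = S i j * a i + b * d ∧
      (r + 1) * a k = S i k * a i + c * d ∧ S i j * b + S i k * c = 0 by
    obtain ⟨b, c, d, e1, e2, e3⟩ := hmain
    have : ((r + 1) ^ 2 - 2) * a i = 0 := by
      linear_combination (r + 1) * hi + S i j * e1 + S i k * e2 + d * e3
        + a i * q1 + a i * q2
    exact (mul_eq_zero.1 this).resolve_left hsq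
  by_cases hl : ∃ l, l ≠ i ∧ l ≠ j ∧ S j l ≠ 0
  · obtain ⟨l, hli, hlj, h3⟩ := hl
    obtain ⟨hkl, hil0, h6⟩ := h.eq_zero_of_cherry_of_ne hμ hμ0 hμ1 ht hij hik hli.symm hjk
      hlj.symm h1 h2 h4 h3
    refine ⟨S j l, S k l, a l, ?_, ?_,
      h.cycle hμ1 ht hij hik hli.symm hjk hlj.symm hkl h1 h2 h3 h4 hil0 h6⟩
    · have hsum : ∑ m, S j m * a m = ∑ m ∈ {j, i, l}, S j m * a m := by
        symm
        refine Finset.sum_subset (Finset.subset_univ _) fun m _ hm => ?_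
        simp only [Finset.mem_insert, Finset.mem_singleton, not_or] at hm
        rw [h.eq_zero_of_nonadj hμ hμ0 hμ1 ht hij.symm hlj.symm (Ne.symm hm.1) hli.symm
          (Ne.symm hm.2.1) (Ne.symm hm.2.2) h1' h3 hil0, zero_mul]
      have := ha j
      rw [hsum, Finset.sum_insert (by simp [hij.symm, hlj.symm]), Finset.sum_pair hli.symm, dj,
        h.symm j i] at this
      linarith
    · have hsum : ∑ m, S k m * a m = ∑ m ∈ {k, i, l}, S k m * a m := by
        symm
        refine Finset.sum_subset (Finset.subset_univ _) fun m _ hm => ?_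
        simp only [Finset.mem_insert, Finset.mem_singleton, not_or] at hm
        rw [h.eq_zero_of_nonadj hμ hμ0 hμ1 ht hik.symm hkl (Ne.symm hm.1) hli.symm
          (Ne.symm hm.2.1) (Ne.symm hm.2.2) h2' h6 hil0, zero_mul]
      have := ha k
      rw [hsum, Finset.sum_insert (by simp [hik.symm, hkl]), Finset.sum_pair hli.symm, dk,
        h.symm k i] at this
      linarith
  · push Not at hl
    refine ⟨0, 0, 0, ?_, ?_, by ring⟩
    · have hsum : ∑ m, S j m * a m = ∑ m ∈ {j, i}, S j m * a m := by
        symm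
        refine Finset.sum_subset (Finset.subset_univ _) fun m _ hm => ?_
        simp only [Finset.mem_insert, Finset.mem_singleton, not_or] at hm
        rw [hl m hm.2 hm.1, zero_mul]
      have := ha j
      rw [hsum, Finset.sum_pair hij.symm, dj, h.symm j i] at this
      linarith
    · have hsum : ∑ m, S k m * a m = ∑ m ∈ {k, i}, S k m * a m := by
        symm
        refine Finset.sum_subset (Finset.subset_univ _) fun m _ hm => ?_
        simp only [Finset.mem_insert, Finset.mem_singleton, not_or] at hm
        by_cases hkm : S k m = 0
        · rw [hkm, zero_mul]
        · obtain ⟨hjm, -, h7⟩ := h.eq_zero_of_cherry_of_ne hμ hμ0 hμ1 ht hik hij (Ne.symm hm.2)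
            hjk.symm (Ne.symm hm.1) h2 h1 (h.symm j k ▸ h4) hkm
          exact absurd (hl m hm.2 (Ne.symm hjm)) h7
      have := ha k
      rw [hsum, Finset.sum_pair hik.symm, dk, h.symm k i] at this
      linarith

/-- `S` has no eigenvalue less than `-1 - √2`. -/
lemma eigenvector_eq_zero {a : V → ℝ} {r : ℝ} (hr : r < -1 - Real.sqrt 2)
    (ha : ∀ i, ∑ j, S i j * a j = r * a i) (i : V) : a i = 0 := by
  have hr2 : r < -2 := by
    have : (1 : ℝ) < Real.sqrt 2 := Real.lt_sqrt_of_sq_lt (by norm_num)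
    linarith
  have two_nbrs : ∀ i j k, i ≠ j → i ≠ k → j ≠ k → S i j ≠ 0 → S i k ≠ 0 → a i = 0 := by
    intro i j k hij hik hjk h1 h2
    by_cases h4 : S j k = 0
    · exact h.eigenvector_eq_zero_of_cherry hμ hμ0 hμ1 ht hr ha hij hik hjk h1 h2 h4
    · exact h.eigenvector_eq_zero_of_triangle hμ hμ0 hμ1 ht hr2 ha hij hik hjk h1 h2 h4
  have one_nbr : ∀ i j, i ≠ j → S i j ≠ 0 → (∀ k, k ≠ i → k ≠ j → S i k = 0) →
      (r + 1) * a i = S i j * a j := by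
    intro i j hij h1 hl
    have hsum : ∑ m, S i m * a m = ∑ m ∈ {i, j}, S i m * a m := by
      symm
      refine Finset.sum_subset (Finset.subset_univ _) fun m _ hm => ?_
      simp only [Finset.mem_insert, Finset.mem_singleton, not_or] at hm
      rw [hl m hm.1 hm.2, zero_mul]
    have := ha i
    rw [hsum, Finset.sum_pair hij, h.diag_eq_neg_one hμ1 ht hij h1] at this
    linarith
  by_cases hj : ∃ j, i ≠ j ∧ S i j ≠ 0
  · obtain ⟨j, hij, h1⟩ := hj
    by_cases hk : ∃ k, k ≠ i ∧ k ≠ j ∧ S i k ≠ 0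
    · obtain ⟨k, hki, hkj, h2⟩ := hk
      exact two_nbrs i j k hij hki.symm hkj.symm h1 h2
    · push Not at hk
      have e1 := one_nbr i j hij h1 hk
      have h1' : S j i ≠ 0 := h.symm i j ▸ h1
      by_cases hl : ∃ k, k ≠ j ∧ k ≠ i ∧ S j k ≠ 0
      · obtain ⟨k, hkj, hki, h2⟩ := hl
        rw [two_nbrs j i k hij.symm hkj.symm hki.symm h1' h2, mul_zero] at e1
        exact (mul_eq_zero.1 e1).resolve_left (by linarith)
      · push Not at hl
        have e2 := one_nbr j i hij.symm h1' hl
        rw [h.symm j i] at e2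
        have q := h.mul_self_eq_one hμ1 ht hij h1
        have : ((r + 1) ^ 2 - 1) * a i = 0 := by
          linear_combination (r + 1) * e1 + S i j * e2 + a i * q
        refine (mul_eq_zero.1 this).resolve_left ?_
        nlinarith
  · push Not at hj
    have := ha i
    rw [Finset.sum_eq_single i (fun m _ hm => by rw [hj m (Ne.symm hm), zero_mul]) (by simp)]
      at this
    have h0 : (S i i - r) * a i = 0 := by rw [sub_mul, this, sub_self]
    refine (mul_eq_zero.1 h0).resolve_left ?_
    rcases h.diag i with hd | hd <;> rw [hd] <;> linarith

lemma form_add_nonneg (a : V → ℝ) :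
    0 ≤ ∑ i, ∑ j, a i * a j * S i j + (1 + Real.sqrt 2) * ∑ i, a i ^ 2 := by
  have hM : (Matrix.of S - algebraMap ℝ (Matrix V V ℝ) (-(1 + Real.sqrt 2))).IsHermitian := by
    refine Matrix.IsHermitian.sub (Matrix.IsHermitian.ext fun i j => ?_) ?_
    · simpa using h.symm j i
    · rw [Matrix.algebraMap_eq_diagonal]
      exact Matrix.isHermitian_diagonal _
  have hrow : ∀ (u : V → ℝ) (e : ℝ),
      (Matrix.of S - algebraMap ℝ (Matrix V V ℝ) (-(1 + Real.sqrt 2))).mulVec u = e • u →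
      ∀ i, ∑ j, S i j * u j = (e - (1 + Real.sqrt 2)) * u i := by
    intro u e hu i
    have h3 := congrFun hu i
    rw [Matrix.sub_mulVec, Matrix.algebraMap_eq_diagonal] at h3
    simp only [Pi.sub_apply, Matrix.mulVec_diagonal, Pi.smul_apply, smul_eq_mul] at h3
    simp only [Matrix.mulVec, dotProduct, Matrix.of_apply, Pi.algebraMap_apply,
      Algebra.algebraMap_self, RingHom.id_apply] at h3
    linarith
  have hpos : (Matrix.of S - algebraMap ℝ (Matrix V V ℝ) (-(1 + Real.sqrt 2))).PosSemidef := by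
    rw [hM.posSemidef_iff_eigenvalues_nonneg]
    intro p
    by_contra hneg
    have hneg' : hM.eigenvalues p < 0 := not_le.1 hneg
    have h1 := hM.mulVec_eigenvectorBasis p
    have h2 : (hM.eigenvectorBasis p) ≠ 0 := hM.eigenvectorBasis.orthonormal.ne_zero p
    apply h2
    ext i
    exact h.eigenvector_eq_zero hμ hμ0 hμ1 ht (a := (hM.eigenvectorBasis p).ofLp)
      (r := hM.eigenvalues p - (1 + Real.sqrt 2)) (by linarith) (hrow _ _ h1) i
  have := (Matrix.posSemidef_iff_dotProduct_mulVec.1 hpos).2 a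
  rw [form_sub_algebraMap] at this
  simp only [Matrix.of_apply] at this
  linarith

end IsLocallyBounded

end LocalStructure

lemma exists_indepSet_or_clique (s N : ℕ) : ∃ R : ℕ, ∀ {V : Type} (G : SimpleGraph V)
    (W : Finset V), R ≤ W.card →
      (∃ I ⊆ W, I.card = s ∧ G.IsIndepSet (I : Set V)) ∨
      (∃ C ⊆ W, C.card = N ∧ G.IsClique (C : Set V)) := by
  induction s generalizing N with
  | zero => exact ⟨0, fun G W _ => .inl ⟨∅, by simp, rfl, by simp⟩⟩
  | succ s ihs =>
    induction N with
    | zero => exact ⟨0, fun G W _ => .inr ⟨∅, by simp, rfl, by simp⟩⟩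
    | succ N ihN =>
      obtain ⟨R₁, h₁⟩ := ihs (N + 1)
      obtain ⟨R₂, h₂⟩ := ihN
      refine ⟨R₁ + R₂ + 1, fun {V} G W hW => ?_⟩
      obtain ⟨v, hv⟩ : W.Nonempty := Finset.card_pos.1 (by omega)
      have hcard := Finset.card_filter_add_card_filter_not (s := W.erase v) (fun w => G.Adj v w)
      rw [Finset.card_erase_of_mem hv] at hcard
      by_cases hA : R₂ ≤ ((W.erase v).filter fun w => G.Adj v w).card
      · rcases h₂ G _ hA with ⟨I, hI, hc, hi⟩ | ⟨C, hC, hc, hi⟩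
        · exact .inl ⟨I, fun w hw => Finset.mem_of_mem_erase (Finset.mem_filter.1 (hI hw)).1,
            hc, hi⟩
        · have hvC : v ∉ C := fun hvC => by simpa using (Finset.mem_filter.1 (hC hvC)).1
          refine .inr ⟨insert v C, ?_, by rw [Finset.card_insert_of_notMem hvC, hc], ?_⟩
          · exact Finset.insert_subset hv fun w hw =>
              Finset.mem_of_mem_erase (Finset.mem_filter.1 (hC hw)).1
          · rw [Finset.coe_insert, isClique_insert]
            exact ⟨hi, fun w hw _ => (Finset.mem_filter.1 (hC hw)).2⟩
      · have hB : R₁ ≤ ((W.erase v).filter fun w => ¬ G.Adj v w).card := by omega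
        rcases h₁ G _ hB with ⟨I, hI, hc, hi⟩ | ⟨C, hC, hc, hi⟩
        · have hvI : v ∉ I := fun hvI => by simpa using (Finset.mem_filter.1 (hI hvI)).1
          refine .inl ⟨insert v I, ?_, by rw [Finset.card_insert_of_notMem hvI, hc], ?_⟩
          · exact Finset.insert_subset hv fun w hw =>
              Finset.mem_of_mem_erase (Finset.mem_filter.1 (hI hw)).1
          · rw [Finset.coe_insert, IsIndepSet, Set.pairwise_insert]
            exact ⟨hi, fun w hw _ => ⟨(Finset.mem_filter.1 (hI hw)).2,
              fun h => (Finset.mem_filter.1 (hI hw)).2 h.symm⟩⟩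
        · exact .inr ⟨C, fun w hw => Finset.mem_of_mem_erase (Finset.mem_filter.1 (hC hw)).1,
            hc, hi⟩

section Gram

variable {V E : Type} [NormedAddCommGroup E] [InnerProductSpace ℝ E] {G : SimpleGraph V}
  {x : V → E} {t : ℝ}
  (hx : ∀ v w, inner ℝ (x v) (x w) = if v = w then t else if G.Adj v w then 1 else 0)

/-- The barycentre of the vectors indexed by `C`. -/
noncomputable def barycentre (x : V → E) (C : Finset V) : E := (C.card : ℝ)⁻¹ • ∑ v ∈ C, x v

lemma inner_barycentre (z : E) (C : Finset V) :
    inner ℝ z (barycentre x C) = (C.card : ℝ)⁻¹ * ∑ v ∈ C, inner ℝ z (x v) := by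
  rw [barycentre, inner_smul_right, inner_sum]

include hx

lemma inner_sum_sum_of_isClique {C P Q : Finset V} (hC : G.IsClique (C : Set V)) (hP : P ⊆ C)
    (hQ : Q ⊆ C) : inner ℝ (∑ v ∈ P, x v) (∑ v ∈ Q, x v) =
      (P.card : ℝ) * Q.card + (t - 1) * (P ∩ Q).card := by
  rw [sum_inner]
  have : ∀ v ∈ P, inner ℝ (x v) (∑ w ∈ Q, x w) = Q.card + if v ∈ Q then (t - 1) else 0 := by
    intro v hv
    rw [inner_sum]
    have : ∀ w ∈ Q, inner ℝ (x v) (x w) = 1 + if v = w then (t - 1) else 0 := by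
      intro w hw
      rw [hx]
      by_cases hvw : v = w
      · simp [hvw]
      · simp [hvw, hC (hP hv) (hQ hw) hvw]
    rw [Finset.sum_congr rfl this, Finset.sum_add_distrib, Finset.sum_ite_eq]
    simp
  rw [Finset.sum_congr rfl this, Finset.sum_add_distrib, ← Finset.sum_filter,
    Finset.filter_mem_eq_inter]
  simp only [Finset.sum_const, nsmul_eq_mul]
  ring

lemma gram_nonneg (v : V) : 0 ≤ t := by
  have := real_inner_self_nonneg (x := x v)
  rwa [hx, if_pos rfl] at this

variable (ht : t ≤ 5 / 2)
include ht

lemma inner_barycentre_self_le {C : Finset V} (hC : G.IsClique (C : Set V)) (h0 : C.Nonempty) :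
    |inner ℝ (barycentre x C) (barycentre x C) - 1| ≤ 3 / 2 / C.card := by
  obtain ⟨v, -⟩ := id h0
  have ht0 := gram_nonneg hx v
  have hc : (0 : ℝ) < C.card := by exact_mod_cast Finset.card_pos.2 h0
  have : inner ℝ (barycentre x C) (barycentre x C) - 1 = (t - 1) / C.card := by
    rw [barycentre, inner_smul_left, inner_smul_right,
      inner_sum_sum_of_isClique hx hC subset_rfl subset_rfl, Finset.inter_self]
    simp only [conj_trivial]
    field_simp
    ring
  rw [this, abs_div, abs_of_pos hc]
  gcongr
  rw [abs_le]
  constructor <;> linarith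

lemma card_lt_or_card_lt {C P Q : Finset V} (hC : G.IsClique (C : Set V)) (hP : P ⊆ C)
    (hQ : Q ⊆ C) (hPQ : Disjoint P Q) {z : E} (hz : inner ℝ z z ≤ 3) {β : ℝ} (hβ : β ≤ 1 / 4)
    (h1 : ∀ v ∈ P, 1 - β ≤ inner ℝ z (x v)) (h2 : ∀ v ∈ Q, inner ℝ z (x v) ≤ β) :
    P.card < 40 ∨ Q.card < 40 := by
  by_contra! hcon
  obtain ⟨hp, hq⟩ := hcon
  have hp' : (40 : ℝ) ≤ P.card := by exact_mod_cast hp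
  have hq' : (40 : ℝ) ≤ Q.card := by exact_mod_cast hq
  obtain ⟨v, hv⟩ : P.Nonempty := Finset.card_pos.1 (by omega)
  have hpp := inner_sum_sum_of_isClique hx hC hP hP
  have hqq := inner_sum_sum_of_isClique hx hC hQ hQ
  have hpq := inner_sum_sum_of_isClique hx hC hP hQ
  rw [Finset.inter_self] at hpp hqq
  rw [Finset.disjoint_iff_inter_eq_empty.1 hPQ, Finset.card_empty, Nat.cast_zero, mul_zero,
    add_zero] at hpq
  set D := barycentre x P - barycentre x Q with hD
  have hDD : inner ℝ D D = (t - 1) / P.card + (t - 1) / Q.card := by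
    rw [hD, inner_sub_left, inner_sub_right, inner_sub_right,
      real_inner_comm (barycentre x P) (barycentre x Q)]
    simp only [barycentre, inner_smul_left, inner_smul_right, hpp, hqq, hpq, conj_trivial]
    field_simp
    ring
  have hDD' : inner ℝ D D ≤ 3 / 40 := by
    have e1 : (t - 1) / P.card ≤ (3 / 2) / 40 := by
      rw [div_le_div_iff₀ (by linarith) (by norm_num)]; linarith
    have e2 : (t - 1) / Q.card ≤ (3 / 2) / 40 := by
      rw [div_le_div_iff₀ (by linarith) (by norm_num)]; linarith
    rw [hDD]; linarith
  have hzP : 1 - β ≤ inner ℝ z (barycentre x P) := by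
    rw [inner_barycentre, le_inv_mul_iff₀ (by linarith), ← nsmul_eq_mul]
    exact Finset.card_nsmul_le_sum _ _ _ h1
  have hzQ : inner ℝ z (barycentre x Q) ≤ β := by
    rw [inner_barycentre, inv_mul_le_iff₀ (by linarith), ← nsmul_eq_mul]
    exact Finset.sum_le_card_nsmul _ _ _ h2
  have hzD : 1 / 2 ≤ inner ℝ z D := by
    rw [hD, inner_sub_right]; linarith
  have hcs := real_inner_mul_inner_self_le z D
  have h0 := real_inner_self_nonneg (x := D)
  nlinarith

lemma inner_barycentre_dichotomy {C : Finset V} (hC : G.IsClique (C : Set V)) (h0 : C.Nonempty)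
    {z : E} (hz : inner ℝ z z ≤ 3) {β : ℝ} (hβ0 : 0 ≤ β) (hβ : β ≤ 1 / 4)
    (h : ∀ v ∈ C, |inner ℝ z (x v)| ≤ β ∨ |inner ℝ z (x v) - 1| ≤ β) :
    |inner ℝ z (barycentre x C)| ≤ β + 100 / C.card ∨
      |inner ℝ z (barycentre x C) - 1| ≤ β + 100 / C.card := by
  have hc : (0 : ℝ) < C.card := by exact_mod_cast Finset.card_pos.2 h0
  set P := C.filter fun v => |inner ℝ z (x v) - 1| ≤ β with hP
  set Q := C.filter fun v => ¬ |inner ℝ z (x v) - 1| ≤ β with hQ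
  have hQ' : ∀ v ∈ Q, |inner ℝ z (x v)| ≤ β := fun v hv => by
    rw [hQ, Finset.mem_filter] at hv
    exact (h v hv.1).resolve_right hv.2
  have hP' : ∀ v ∈ P, |inner ℝ z (x v) - 1| ≤ β := fun v hv => (Finset.mem_filter.1 hv).2
  have hcard : (P.card : ℝ) + Q.card = C.card := by
    exact_mod_cast Finset.card_filter_add_card_filter_not (s := C) _
  have hp0 : (0 : ℝ) ≤ P.card := Nat.cast_nonneg _
  have hq0 : (0 : ℝ) ≤ Q.card := Nat.cast_nonneg _
  have key : ∀ (g : V → ℝ) (A B : Finset V), (∀ v ∈ A, |g v| ≤ β) → (∀ v ∈ B, |g v| ≤ 2) →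
      (B.card : ℝ) ≤ 40 → (A.card : ℝ) ≤ C.card →
      |(C.card : ℝ)⁻¹ * (∑ v ∈ A, g v + ∑ v ∈ B, g v)| ≤ β + 100 / C.card := by
    intro g A B hA hB hB' hA'
    rw [abs_mul, abs_of_pos (inv_pos.2 hc), inv_mul_le_iff₀ hc, mul_add,
      mul_div_cancel₀ _ hc.ne']
    have e1 : |∑ v ∈ A, g v| ≤ A.card * β := by
      rw [← nsmul_eq_mul]
      exact (Finset.abs_sum_le_sum_abs _ _).trans (Finset.sum_le_card_nsmul _ _ _ hA)
    have e2 : |∑ v ∈ B, g v| ≤ B.card * 2 := by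
      rw [← nsmul_eq_mul]
      exact (Finset.abs_sum_le_sum_abs _ _).trans (Finset.sum_le_card_nsmul _ _ _ hB)
    have e3 : (A.card : ℝ) * β ≤ C.card * β := by gcongr
    linarith [abs_add_le (∑ v ∈ A, g v) (∑ v ∈ B, g v)]
  rcases card_lt_or_card_lt hx ht hC (Finset.filter_subset _ _) (Finset.filter_subset _ _)
    (Finset.disjoint_filter_filter_not C C _) hz hβ
    (fun v hv => by have := abs_le.1 (hP' v hv); linarith)
    (fun v hv => (abs_le.1 (hQ' v hv)).2) with hlt | hlt
  · left
    have := key (fun v => inner ℝ z (x v)) Q P hQ'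
      (fun v hv => by
        have := abs_le.1 (hP' v hv)
        rw [abs_le]; constructor <;> linarith)
      (by exact_mod_cast hlt.le) (by linarith)
    rwa [add_comm, Finset.sum_filter_add_sum_filter_not, ← inner_barycentre] at this
  · right
    have := key (fun v => inner ℝ z (x v) - 1) P Q hP'
      (fun v hv => by
        have := abs_le.1 (hQ' v hv)
        rw [abs_le]; constructor <;> linarith)
      (by exact_mod_cast hlt.le) (by linarith)
    rwa [Finset.sum_filter_add_sum_filter_not, Finset.sum_sub_distrib, mul_sub,
      ← inner_barycentre, Finset.sum_const, nsmul_eq_mul, mul_one, inv_mul_cancel₀ hc.ne'] at this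

lemma inner_vertex_barycentre {C : Finset V} (hC : G.IsClique (C : Set V)) (h0 : C.Nonempty)
    (w : V) : |inner ℝ (x w) (barycentre x C)| ≤ 100 / C.card ∨
      |inner ℝ (x w) (barycentre x C) - 1| ≤ 100 / C.card := by
  by_cases hw : w ∈ C
  · right
    have hc : (0 : ℝ) < C.card := by exact_mod_cast Finset.card_pos.2 h0
    have ht0 := gram_nonneg hx w
    have : inner ℝ (x w) (barycentre x C) - 1 = (t - 1) / C.card := by
      have e := inner_sum_sum_of_isClique hx hC (Finset.singleton_subset_iff.2 hw) subset_rfl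
      rw [Finset.sum_singleton, Finset.singleton_inter_of_mem hw] at e
      rw [barycentre, inner_smul_right, e]
      simp
      field_simp
      ring
    rw [this, abs_div, abs_of_pos hc]
    gcongr
    rw [abs_le]
    constructor <;> linarith
  · have := inner_barycentre_dichotomy hx ht hC h0 (z := x w) (β := 0)
      (by rw [hx, if_pos rfl]; linarith) le_rfl (by norm_num) (fun v hv => by
        rw [hx, if_neg (by rintro rfl; exact hw hv)]
        split_ifs <;> simp)
    simpa using this

lemma inner_barycentre_barycentre {C C' : Finset V} (hC : G.IsClique (C : Set V))
    (hC' : G.IsClique (C' : Set V)) {N : ℕ} (hN : 2000 ≤ N) (hcard : C.card = N)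
    (hcard' : C'.card = N) : |inner ℝ (barycentre x C) (barycentre x C')| ≤ 200 / N ∨
      |inner ℝ (barycentre x C) (barycentre x C') - 1| ≤ 200 / N := by
  have hN' : (2000 : ℝ) ≤ N := by exact_mod_cast hN
  have h0 : C.Nonempty := Finset.card_pos.1 (by omega)
  have h0' : C'.Nonempty := Finset.card_pos.1 (by omega)
  have hs := (abs_le.1 (inner_barycentre_self_le hx ht hC h0)).2
  rw [hcard] at hs
  have e1 : (3 / 2 : ℝ) / N ≤ 1 := by rw [div_le_one (by linarith)]; linarith
  have e2 : (100 : ℝ) / N ≤ 1 / 4 := by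
    rw [div_le_div_iff₀ (by linarith) (by norm_num)]; linarith
  have e3 : (100 : ℝ) / N + 100 / N = 200 / N := by ring
  have := inner_barycentre_dichotomy hx ht hC' h0' (z := barycentre x C) (β := 100 / N)
    (by linarith) (by positivity) e2 (fun v _ => by
      have := inner_vertex_barycentre hx ht hC h0 v
      rwa [hcard, real_inner_comm] at this)
  rwa [hcard', e3] at this

lemma card_ne_seven_of_isIndepSet {I : Finset V} (hI : G.IsIndepSet (I : Set V)) {v : V}
    (hv : ∀ w ∈ I, G.Adj v w) : I.card ≠ 7 := by
  intro hc
  have e1 : inner ℝ (x v) (∑ w ∈ I, x w) = 7 := by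
    rw [inner_sum, Finset.sum_congr rfl fun w hw => (hx v w).trans
      (by rw [if_neg (hv w hw).ne, if_pos (hv w hw)])]
    simp [hc]
  have e2 : inner ℝ (∑ w ∈ I, x w) (∑ w ∈ I, x w) = 7 * t := by
    rw [sum_inner]
    have : ∀ u ∈ I, inner ℝ (x u) (∑ w ∈ I, x w) = t := by
      intro u hu
      rw [inner_sum, Finset.sum_eq_single u, hx, if_pos rfl]
      · intro w hw hwu
        rw [hx, if_neg hwu.symm, if_neg (hI hu hw hwu.symm)]
      · exact fun h => absurd hu h
    rw [Finset.sum_congr rfl this]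
    simp [hc]
  have h := real_inner_self_nonneg (x := (5 / 2 : ℝ) • x v - ∑ w ∈ I, x w)
  rw [inner_sub_left, inner_sub_right, inner_sub_right, inner_smul_left, inner_smul_right,
    inner_smul_left, inner_smul_right, real_inner_comm (x v) (∑ w ∈ I, x w), e1, e2, hx,
    if_pos rfl] at h
  simp only [conj_trivial] at h
  linarith

omit hx ht

lemma exists_barycentre_family {N : ℕ} (hN : 2000 ≤ N) : ∃ K : ℕ,
    ∀ {V E : Type} [Fintype V] [NormedAddCommGroup E] [InnerProductSpace ℝ E]
      {G : SimpleGraph V} {x : V → E} {t : ℝ},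
      (∀ v w, inner ℝ (x v) (x w) = if v = w then t else if G.Adj v w then 1 else 0) →
      t ≤ 5 / 2 → (∀ v, K ≤ (Finset.univ.filter (G.Adj v)).card) →
      ∃ F : Finset (Finset V),
        (∀ C ∈ F, |inner ℝ (barycentre x C) (barycentre x C) - 1| ≤ 200 / N) ∧
        (∀ C ∈ F, ∀ C' ∈ F, C ≠ C' →
          |inner ℝ (barycentre x C) (barycentre x C')| ≤ 200 / N) ∧
        (∀ v, ∀ C ∈ F, |inner ℝ (x v) (barycentre x C)| ≤ 200 / N ∨
          |inner ℝ (x v) (barycentre x C) - 1| ≤ 200 / N) ∧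
        ∀ v, ∃ C ∈ F, |inner ℝ (x v) (barycentre x C) - 1| ≤ 200 / N := by
  obtain ⟨K, hK⟩ := exists_indepSet_or_clique 7 N
  refine ⟨K, fun {V E} _ _ _ {G x t} hx ht hdeg => ?_⟩
  have hN' : (2000 : ℝ) ≤ N := by exact_mod_cast hN
  have e100 : (100 : ℝ) / N ≤ 200 / N := by gcongr; norm_num
  set A : Finset (Finset (Finset V)) := Finset.univ.filter fun F =>
    (∀ C ∈ F, C.card = N ∧ G.IsClique (C : Set V)) ∧ ∀ C ∈ F, ∀ C' ∈ F, C ≠ C' →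
      |inner ℝ (barycentre x C) (barycentre x C')| ≤ 200 / N with hA
  obtain ⟨F, hFA, hmax⟩ := A.exists_max_image Finset.card ⟨∅, by simp [hA]⟩
  obtain ⟨hF1, hF2⟩ := (Finset.mem_filter.1 hFA).2
  have hne : ∀ C : Finset V, C.card = N → C.Nonempty := fun C hC => Finset.card_pos.1 (by omega)
  have hF3 : ∀ v, ∀ C ∈ F, |inner ℝ (x v) (barycentre x C)| ≤ 100 / N ∨
      |inner ℝ (x v) (barycentre x C) - 1| ≤ 100 / N := fun v C hC => by
    have := inner_vertex_barycentre hx ht (hF1 C hC).2 (hne C (hF1 C hC).1) v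
    rwa [(hF1 C hC).1] at this
  have hself : ∀ C : Finset V, C.card = N → G.IsClique (C : Set V) →
      |inner ℝ (barycentre x C) (barycentre x C) - 1| ≤ 3 / 2 / N := fun C hc hC => by
    have := inner_barycentre_self_le hx ht hC (hne C hc)
    rwa [hc] at this
  refine ⟨F, fun C hC => (hself C (hF1 C hC).1 (hF1 C hC).2).trans (by gcongr; norm_num), hF2,
    fun v C hC => (hF3 v C hC).imp (fun h => h.trans e100) fun h => h.trans e100, fun v => ?_⟩
  obtain ⟨C, hCv, hCN, hC⟩ : ∃ C ⊆ Finset.univ.filter (G.Adj v), C.card = N ∧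
      G.IsClique (C : Set V) := by
    refine (hK G _ (hdeg v)).resolve_left ?_
    rintro ⟨I, hIv, hI7, hI⟩
    exact card_ne_seven_of_isIndepSet hx ht hI
      (fun w hw => (Finset.mem_filter.1 (hIv hw)).2) hI7
  have hvC : inner ℝ (x v) (barycentre x C) = 1 := by
    rw [inner_barycentre, Finset.sum_congr rfl fun w hw => (hx v w).trans
      (by rw [if_neg ((Finset.mem_filter.1 (hCv hw)).2).ne,
        if_pos (Finset.mem_filter.1 (hCv hw)).2])]
    simp only [Finset.sum_const, nsmul_eq_mul, mul_one, hCN]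
    exact inv_mul_cancel₀ (by linarith)
  by_cases hCF : C ∈ F
  · exact ⟨C, hCF, by rw [hvC]; simp; positivity⟩
  obtain ⟨C', hC'F, hC'⟩ : ∃ C' ∈ F,
      ¬ |inner ℝ (barycentre x C) (barycentre x C')| ≤ 200 / N := by
    by_contra! hcon
    have hins : insert C F ∈ A := by
      refine Finset.mem_filter.2 ⟨Finset.mem_univ _, fun D hD => ?_, fun D hD D' hD' hne => ?_⟩
      · rcases Finset.mem_insert.1 hD with rfl | hD
        · exact ⟨hCN, hC⟩
        · exact hF1 D hD
      · rcases Finset.mem_insert.1 hD with h1 | h1 <;>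
          rcases Finset.mem_insert.1 hD' with h2 | h2
        · exact absurd (h1.trans h2.symm) hne
        · exact h1 ▸ hcon D' h2
        · rw [real_inner_comm]; exact h2 ▸ hcon D h1
        · exact hF2 D h1 D' h2 hne
    have := hmax _ hins
    rw [Finset.card_insert_of_notMem hCF] at this
    omega
  refine ⟨C', hC'F, ((hF3 v C' hC'F).resolve_left fun hv => ?_).trans e100⟩
  have h1 := (inner_barycentre_barycentre hx ht hC (hF1 C' hC'F).2 hN hCN
    (hF1 C' hC'F).1).resolve_left hC'
  have h2 := hself C hCN hC
  have h3 := hself C' (hF1 C' hC'F).1 (hF1 C' hC'F).2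
  have hDD : inner ℝ (barycentre x C - barycentre x C') (barycentre x C - barycentre x C') ≤
      403 / N := by
    rw [inner_sub_left, inner_sub_right, inner_sub_right,
      real_inner_comm (barycentre x C) (barycentre x C')]
    have e : (403 : ℝ) / N = 3 / 2 / N + 3 / 2 / N + 2 * (200 / N) := by ring
    rw [abs_le] at h1 h2 h3
    linarith
  have hDD' : (403 : ℝ) / N ≤ 403 / 2000 := by gcongr
  have hvD : 3 / 4 ≤ inner ℝ (x v) (barycentre x C - barycentre x C') := by
    rw [inner_sub_right, hvC]
    have : (100 : ℝ) / N ≤ 100 / 2000 := by gcongr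
    have := (abs_le.1 hv).2
    linarith
  have hcs := real_inner_mul_inner_self_le (x v) (barycentre x C - barycentre x C')
  rw [hx v v, if_pos rfl] at hcs
  have hnn := real_inner_self_nonneg (x := barycentre x C - barycentre x C')
  have ht0 := gram_nonneg hx v
  nlinarith

end Gram

section Approx

variable {V E ι : Type} [NormedAddCommGroup E] [InnerProductSpace ℝ E] {G : SimpleGraph V}
  {x : V → E} {t δ : ℝ} {F : Finset ι} {f : ι → E}

/-- The indices of the vectors `f C`, `C ∈ F`, having inner product approximately `1` with `z`. -/
noncomputable def approxNbrs (F : Finset ι) (f : ι → E) (δ : ℝ) (z : E) : Finset ι :=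
  F.filter fun C => |inner ℝ z (f C) - 1| ≤ δ

/-- The adjacency matrix of `G` minus the matrix counting common approximate neighbours. -/
noncomputable def reducedMatrix (G : SimpleGraph V) (F : Finset ι) (f : ι → E) (δ : ℝ)
    (x : V → E) (v w : V) : ℝ :=
  (if G.Adj v w then 1 else 0) -
    ((approxNbrs F f δ (x v) ∩ approxNbrs F f δ (x w)).card : ℝ)

variable (hx : ∀ v w, inner ℝ (x v) (x w) = if v = w then t else if G.Adj v w then 1 else 0)
  (hF1 : ∀ C ∈ F, |inner ℝ (f C) (f C) - 1| ≤ δ)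
  (hF2 : ∀ C ∈ F, ∀ C' ∈ F, C ≠ C' → |inner ℝ (f C) (f C')| ≤ δ)
  (hF3 : ∀ v, ∀ C ∈ F, |inner ℝ (x v) (f C)| ≤ δ ∨ |inner ℝ (x v) (f C) - 1| ≤ δ)
  (hF4 : ∀ v, ∃ C ∈ F, |inner ℝ (x v) (f C) - 1| ≤ δ)

include hF4 in
lemma one_le_card_approxNbrs (v : V) : 1 ≤ (approxNbrs F f δ (x v)).card := by
  obtain ⟨C, hC, h⟩ := hF4 v
  exact Finset.card_pos.2 ⟨C, Finset.mem_filter.2 ⟨hC, h⟩⟩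

include hF1 hF2 in
lemma abs_inner_sub_ite_le {C C' : ι} (hC : C ∈ F) (hC' : C' ∈ F) :
    |inner ℝ (f C) (f C') - if C = C' then 1 else 0| ≤ δ := by
  split_ifs with h
  · exact h ▸ hF1 C hC
  · simpa using hF2 C hC C' hC' h

lemma abs_sum_sub_sum_le {s : Finset ι} {g h : ι → ℝ} {c : ℝ} (hgh : ∀ C ∈ s, |g C - h C| ≤ c) :
    |∑ C ∈ s, g C - ∑ C ∈ s, h C| ≤ s.card * c := by
  rw [← Finset.sum_sub_distrib, ← nsmul_eq_mul]
  exact (Finset.abs_sum_le_sum_abs _ _).trans (Finset.sum_le_card_nsmul _ _ _ hgh)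

include hF1 hF2 in
lemma abs_inner_sum_sum_sub_le {s u : Finset ι} (hs : s ⊆ F) (hu : u ⊆ F) :
    |inner ℝ (∑ C ∈ s, f C) (∑ C ∈ u, f C) - (s ∩ u).card| ≤ s.card * (u.card * δ) := by
  have e : ((s ∩ u).card : ℝ) = ∑ C ∈ s, ∑ C' ∈ u, if C = C' then 1 else 0 := by
    simp only [Finset.sum_ite_eq]
    rw [← Finset.sum_filter, Finset.filter_mem_eq_inter]
    simp
  rw [e, sum_inner]
  refine abs_sum_sub_sum_le fun C hC => ?_
  rw [inner_sum]
  exact abs_sum_sub_sum_le fun C' hC' => abs_inner_sub_ite_le hF1 hF2 (hs hC) (hu hC')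

include hF3 in
lemma abs_inner_sum_sub_le (v : V) {s : Finset ι} (hs : s ⊆ F) :
    |inner ℝ (x v) (∑ C ∈ s, f C) - (approxNbrs F f δ (x v) ∩ s).card| ≤ s.card * δ := by
  have e : ((approxNbrs F f δ (x v) ∩ s).card : ℝ) =
      ∑ C ∈ s, if C ∈ approxNbrs F f δ (x v) then 1 else 0 := by
    rw [← Finset.sum_filter, Finset.filter_mem_eq_inter, Finset.inter_comm]
    simp
  rw [e, inner_sum]
  refine abs_sum_sub_sum_le fun C hC => ?_
  split_ifs with h
  · exact (Finset.mem_filter.1 h).2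
  · rw [sub_zero]
    exact (hF3 v C (hs hC)).resolve_right fun h' => h (Finset.mem_filter.2 ⟨hs hC, h'⟩)

variable (ht : t ≤ 5 / 2) (hδ : δ < 1 / 30)

include hx hF1 hF2 hF3 ht hδ in
lemma card_approxNbrs_le_two (v : V) : (approxNbrs F f δ (x v)).card ≤ 2 := by
  by_contra! hcon
  obtain ⟨s, hs, hs3⟩ := Finset.exists_subset_card_eq (Nat.succ_le_of_lt hcon)
  have hsF : s ⊆ F := hs.trans (Finset.filter_subset _ _)
  have h1 := abs_inner_sum_sum_sub_le hF1 hF2 hsF hsF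
  have h2 := abs_inner_sum_sub_le hF3 v hsF
  rw [Finset.inter_eq_right.2 hs] at h2
  rw [Finset.inter_self] at h1
  rw [hs3] at h1 h2
  rw [abs_le] at h1 h2
  push_cast at h1 h2
  have h := real_inner_self_nonneg (x := x v - ∑ C ∈ s, f C)
  rw [inner_sub_left, inner_sub_right, inner_sub_right, real_inner_comm (x v) (∑ C ∈ s, f C), hx,
    if_pos rfl] at h
  linarith

include hx hF1 hF2 hF3 ht hδ in
lemma abs_inner_sub_reducedMatrix_le (hδ0 : 0 ≤ δ) (v w : V) :
    |inner ℝ (x v - ∑ C ∈ approxNbrs F f δ (x v), f C)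
      (x w - ∑ C ∈ approxNbrs F f δ (x w), f C) -
      (reducedMatrix G F f δ x v w + if v = w then t else 0)| ≤ 8 * δ := by
  have hv : ((approxNbrs F f δ (x v)).card : ℝ) ≤ 2 := by
    exact_mod_cast card_approxNbrs_le_two hx hF1 hF2 hF3 ht hδ v
  have hw : ((approxNbrs F f δ (x w)).card : ℝ) ≤ 2 := by
    exact_mod_cast card_approxNbrs_le_two hx hF1 hF2 hF3 ht hδ w
  have hvF : approxNbrs F f δ (x v) ⊆ F := Finset.filter_subset _ _
  have hwF : approxNbrs F f δ (x w) ⊆ F := Finset.filter_subset _ _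
  have h1 := abs_inner_sum_sum_sub_le hF1 hF2 hvF hwF
  have h2 := abs_inner_sum_sub_le hF3 v hwF
  have h3 := abs_inner_sum_sub_le hF3 w hvF
  have hwδ : ((approxNbrs F f δ (x w)).card : ℝ) * δ ≤ 2 * δ := by gcongr
  have hvδ : ((approxNbrs F f δ (x v)).card : ℝ) * δ ≤ 2 * δ := by gcongr
  have hvwδ : ((approxNbrs F f δ (x v)).card : ℝ) * ((approxNbrs F f δ (x w)).card * δ) ≤
      2 * (2 * δ) := by gcongr
  rw [Finset.inter_comm] at h3
  have hadj : (if v = w then t else if G.Adj v w then (1 : ℝ) else 0) =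
      (if v = w then t else 0) + if G.Adj v w then 1 else 0 := by
    split_ifs with h h' <;> simp_all
  rw [inner_sub_left, inner_sub_right, inner_sub_right, hx, hadj, reducedMatrix,
    real_inner_comm (x w) (∑ C ∈ approxNbrs F f δ (x v), f C)]
  rw [abs_le] at *
  constructor <;> linarith

include hx hF1 hF2 hF3 hF4 ht hδ in
lemma isLocallyBounded_reducedMatrix (hδ0 : 0 ≤ δ) :
    IsLocallyBounded (reducedMatrix G F f δ x) (t + 32 * δ) where
  symm i j := by simp only [reducedMatrix, G.adj_comm i j, Finset.inter_comm]
  int i j _ := by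
    refine ⟨(if G.Adj i j then 1 else 0) -
      ((approxNbrs F f δ (x i) ∩ approxNbrs F f δ (x j)).card : ℤ), ?_⟩
    rw [reducedMatrix]
    split_ifs <;> push_cast <;> rfl
  diag i := by
    have h1 := one_le_card_approxNbrs hF4 i
    have h2 := card_approxNbrs_le_two hx hF1 hF2 hF3 ht hδ i
    have : (approxNbrs F f δ (x i)).card = 1 ∨ (approxNbrs F f δ (x i)).card = 2 := by omega
    rw [reducedMatrix, Finset.inter_self, if_neg (G.loopless.irrefl i)]
    rcases this with h | h <;> rw [h] <;> norm_num
  form_nonneg s hs a := by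
    set y : V → E := fun v => x v - ∑ C ∈ approxNbrs F f δ (x v), f C with hy
    have h0 := real_inner_self_nonneg (x := ∑ v ∈ s, a v • y v)
    rw [sum_inner] at h0
    simp only [inner_sum, inner_smul_left, inner_smul_right, conj_trivial] at h0
    have h1 : ∑ v ∈ s, ∑ w ∈ s, a w * (a v * inner ℝ (y v) (y w)) ≤
        ∑ v ∈ s, ∑ w ∈ s, (a v * a w * reducedMatrix G F f δ x v w +
          (if v = w then t * a v ^ 2 else 0) + 8 * δ * (|a v| * |a w|)) := by
      refine Finset.sum_le_sum fun v _ => Finset.sum_le_sum fun w _ => ?_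
      have h := abs_inner_sub_reducedMatrix_le hx hF1 hF2 hF3 ht hδ hδ0 v w
      have h' : a v * a w * (inner ℝ (y v) (y w) -
          (reducedMatrix G F f δ x v w + if v = w then t else 0)) ≤ |a v| * |a w| * (8 * δ) := by
        refine (le_abs_self _).trans ?_
        rw [abs_mul, abs_mul]
        gcongr
      have h'' : (if v = w then t * a v ^ 2 else 0) = a v * a w * if v = w then t else 0 := by
        split_ifs with hvw
        · rw [hvw]; ring
        · rw [mul_zero]
      rw [h'']
      linarith
    have h2 : (∑ v ∈ s, |a v|) ^ 2 ≤ 4 * ∑ v ∈ s, a v ^ 2 := by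
      have := sq_sum_le_card_mul_sum_sq (s := s) (f := fun v => |a v|)
      simp only [sq_abs] at this
      refine this.trans ?_
      have hs' : (s.card : ℝ) ≤ 4 := by exact_mod_cast hs
      gcongr
    have h3 : ∑ v ∈ s, ∑ w ∈ s, 8 * δ * (|a v| * |a w|) = 8 * δ * (∑ v ∈ s, |a v|) ^ 2 := by
      simp only [← Finset.mul_sum]
      rw [sq, Finset.sum_mul_sum]
      simp only [← Finset.mul_sum]
    have h4 : ∑ v ∈ s, ∑ w ∈ s, (if v = w then t * a v ^ 2 else 0) = t * ∑ v ∈ s, a v ^ 2 := by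
      rw [Finset.mul_sum]
      refine Finset.sum_congr rfl fun v hv => ?_
      rw [Finset.sum_ite_eq, if_pos hv]
    simp only [Finset.sum_add_distrib] at h1
    rw [h3, h4] at h1
    have h5 : 8 * δ * (∑ v ∈ s, |a v|) ^ 2 ≤ 8 * δ * (4 * ∑ v ∈ s, a v ^ 2) := by gcongr
    linarith

include hx hF1 hF2 hF3 hF4 ht hδ in
lemma adjMatrix_form_add_nonneg [Fintype V] (hδ0 : 0 ≤ δ) {μ : ℝ}
    (hμ : μ ^ 3 + μ ^ 2 - 3 * μ - 1 = 0) (hμ0 : 0 < μ) (hμ1 : μ ≤ 3 / 2)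
    (htμ : t + 32 * δ < μ + 1) (a : V → ℝ) :
    0 ≤ ∑ v, ∑ w, a v * a w * G.adjMatrix ℝ v w + (1 + Real.sqrt 2) * ∑ v, a v ^ 2 := by
  have h := (isLocallyBounded_reducedMatrix hx hF1 hF2 hF3 hF4 ht hδ hδ0).form_add_nonneg
    hμ hμ0 hμ1 htμ a
  have e : ∑ v, ∑ w, a v * a w *
      ((approxNbrs F f δ (x v) ∩ approxNbrs F f δ (x w)).card : ℝ) =
      ∑ C ∈ F, (∑ v, if C ∈ approxNbrs F f δ (x v) then a v else 0) ^ 2 := by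
    simp only [sq, Finset.sum_mul_sum]
    symm
    rw [Finset.sum_comm]
    refine Finset.sum_congr rfl fun v _ => ?_
    rw [Finset.sum_comm]
    refine Finset.sum_congr rfl fun w _ => ?_
    symm
    have : approxNbrs F f δ (x v) ∩ approxNbrs F f δ (x w) = F.filter fun C =>
        C ∈ approxNbrs F f δ (x v) ∧ C ∈ approxNbrs F f δ (x w) := by
      ext C
      simp only [Finset.mem_inter, Finset.mem_filter, approxNbrs]
      tauto
    rw [this, Finset.card_filter]
    push_cast
    rw [Finset.mul_sum]
    refine Finset.sum_congr rfl fun C _ => ?_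
    by_cases h1 : C ∈ approxNbrs F f δ (x v) <;> by_cases h2 : C ∈ approxNbrs F f δ (x w) <;>
      simp [h1, h2]
  have e2 : ∑ v, ∑ w, a v * a w * G.adjMatrix ℝ v w =
      ∑ v, ∑ w, a v * a w * reducedMatrix G F f δ x v w +
      ∑ v, ∑ w, a v * a w *
        ((approxNbrs F f δ (x v) ∩ approxNbrs F f δ (x w)).card : ℝ) := by
    simp only [← Finset.sum_add_distrib]
    refine Finset.sum_congr rfl fun v _ => Finset.sum_congr rfl fun w _ => ?_
    rw [reducedMatrix, adjMatrix_apply]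
    ring
  have e3 : 0 ≤ ∑ C ∈ F, (∑ v, if C ∈ approxNbrs F f δ (x v) then a v else 0) ^ 2 :=
    Finset.sum_nonneg fun C _ => sq_nonneg _
  rw [e2, e]
  linarith

end Approx

/-- For `μ + 1` larger than `t`, graphs of large minimum degree with smallest eigenvalue at least
`-t` have smallest eigenvalue at least `-1 - √2`. -/
lemma exists_degree_bound {μ t : ℝ} (hμ : μ ^ 3 + μ ^ 2 - 3 * μ - 1 = 0) (hμ0 : 0 < μ)
    (hμ1 : μ ≤ 3 / 2) (ht : t < μ + 1) : ∃ K : ℕ, ∀ {V : Type} [Fintype V] [Nonempty V]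
      (G : SimpleGraph V), (∀ v, K ≤ (Finset.univ.filter (G.Adj v)).card) →
      -t ≤ lambdaMin G → -1 - Real.sqrt 2 ≤ lambdaMin G := by
  obtain ⟨N₀, hN₀⟩ := exists_nat_gt (6400 / (μ + 1 - t))
  set N := max N₀ 7000 with hN
  obtain ⟨K, hK⟩ := exists_barycentre_family (N := N) (by omega)
  refine ⟨K, fun {V} _ _ G hdeg hG => le_lambdaMin_of_forall fun a => ?_⟩
  obtain ⟨m, x, hx⟩ := exists_gram_of_le_lambdaMin hG
  obtain ⟨F, hF1, hF2, hF3, hF4⟩ := hK hx (by linarith) hdeg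
  have hN7 : (7000 : ℝ) ≤ N := by exact_mod_cast le_max_right _ _
  have hNN₀ : (N₀ : ℝ) ≤ N := by exact_mod_cast le_max_left _ _
  have hgap : 6400 < N * (μ + 1 - t) := by
    rw [← div_lt_iff₀ (by linarith)]; linarith
  have := adjMatrix_form_add_nonneg hx hF1 hF2 hF3 hF4 (by linarith)
    (by rw [div_lt_div_iff₀ (by linarith) (by norm_num)]; linarith) (by positivity) hμ hμ0 hμ1
    (by
      have : 32 * (200 / (N : ℝ)) < μ + 1 - t := by
        rw [← mul_div_assoc, div_lt_iff₀ (by linarith)]; linarith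
      linarith) a
  linarith

section PawGraph

variable {X Y Z : Type}

/-- The graph on `Fin 4 × X × Y × Z` formed by a paw with vertices `0, 1, 2, 3` (the triangle
`0, 1, 2` with the pendant edge `0, 3`) for each triple, where the copies of `0` are joined along
the first coordinate, those of `1` and `2` along the second and those of `3` along the third. -/
def pawGraph (X Y Z : Type) : SimpleGraph (Fin 4 × X × Y × Z) where
  Adj v w := v ≠ w ∧
    (v.2 = w.2 ∧ (v.1 = 0 ∨ w.1 = 0 ∨ v.1 ≠ 3 ∧ w.1 ≠ 3) ∨
      v.1 = w.1 ∧ (v.1 = 0 ∧ v.2.2.1 = w.2.2.1 ∧ v.2.2.2 = w.2.2.2 ∨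
        (v.1 = 1 ∨ v.1 = 2) ∧ v.2.1 = w.2.1 ∧ v.2.2.2 = w.2.2.2 ∨
        v.1 = 3 ∧ v.2.1 = w.2.1 ∧ v.2.2.1 = w.2.2.1))
  symm := ⟨by
    rintro ⟨P, x, y, z⟩ ⟨Q, x', y', z'⟩
    grind⟩
  loopless := ⟨fun v h => h.1 rfl⟩

lemma pawGraph_connected [Nonempty X] [Nonempty Y] [Nonempty Z] : (pawGraph X Y Z).Connected := by
  have reach {v w} (h : v ≠ w → (pawGraph X Y Z).Adj v w) : (pawGraph X Y Z).Reachable v w := by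
    by_cases hvw : v = w
    · exact hvw ▸ Reachable.refl v
    · exact (h hvw).reachable
  have h0 (P : Fin 4) (i : X × Y × Z) : (pawGraph X Y Z).Reachable (0, i) (P, i) :=
    reach fun h => ⟨h, Or.inl ⟨rfl, Or.inl rfl⟩⟩
  have h1 (x x' : X) (y : Y) (z : Z) :
      (pawGraph X Y Z).Reachable (0, x, y, z) (0, x', y, z) :=
    reach fun h => ⟨h, Or.inr ⟨rfl, Or.inl ⟨rfl, rfl, rfl⟩⟩⟩
  have h2 (x : X) (y y' : Y) (z : Z) :
      (pawGraph X Y Z).Reachable (1, x, y, z) (1, x, y', z) :=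
    reach fun h => ⟨h, Or.inr ⟨rfl, Or.inr (Or.inl ⟨Or.inl rfl, rfl, rfl⟩)⟩⟩
  have h3 (x : X) (y : Y) (z z' : Z) :
      (pawGraph X Y Z).Reachable (3, x, y, z) (3, x, y, z') :=
    reach fun h => ⟨h, Or.inr ⟨rfl, Or.inr (Or.inr ⟨rfl, rfl, rfl⟩)⟩⟩
  refine Connected.mk ?_
  rintro ⟨P, x, y, z⟩ ⟨Q, x', y', z'⟩
  exact (h0 P _).symm.trans <| (h1 x x' y z).trans <| (h0 1 _).trans <| (h2 x' y y' z).trans <|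
    (h0 1 _).symm.trans <| (h0 3 _).trans <| (h3 x' y' z z').trans <| (h0 3 _).symm.trans (h0 Q _)

variable [Fintype X] [Fintype Y] [Fintype Z] (a : Fin 4 × X × Y × Z → ℝ) (x : X) (y : Y) (z : Z)

lemma pawGraph_row_zero : ∑ w, (pawGraph X Y Z).adjMatrix ℝ (0, x, y, z) w * a w =
    a (1, x, y, z) + a (2, x, y, z) + a (3, x, y, z) + (∑ x', a (0, x', y, z) - a (0, x, y, z)) := by
  have e (w : Fin 4 × X × Y × Z) : (pawGraph X Y Z).adjMatrix ℝ (0, x, y, z) w * a w =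
      (if w = (1, x, y, z) then a w else 0) + (if w = (2, x, y, z) then a w else 0) +
      (if w = (3, x, y, z) then a w else 0) +
      ((if w.1 = 0 then if w.2.2.1 = y then if w.2.2.2 = z then a w else 0 else 0 else 0) -
        if w = (0, x, y, z) then a w else 0) := by
    obtain ⟨Q, x', y', z'⟩ := w
    rw [adjMatrix_apply]
    simp only [pawGraph, Prod.mk.injEq]
    fin_cases Q <;> simp <;> grind
  simp only [e, Finset.sum_add_distrib, Finset.sum_sub_distrib, Finset.sum_ite_eq',
    Finset.mem_univ, if_true]
  simp [Fintype.sum_prod_type]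

lemma pawGraph_row_one : ∑ w, (pawGraph X Y Z).adjMatrix ℝ (1, x, y, z) w * a w =
    a (0, x, y, z) + a (2, x, y, z) + (∑ y', a (1, x, y', z) - a (1, x, y, z)) := by
  have e (w : Fin 4 × X × Y × Z) : (pawGraph X Y Z).adjMatrix ℝ (1, x, y, z) w * a w =
      (if w = (0, x, y, z) then a w else 0) + (if w = (2, x, y, z) then a w else 0) +
      ((if w.1 = 1 then if w.2.1 = x then if w.2.2.2 = z then a w else 0 else 0 else 0) -
        if w = (1, x, y, z) then a w else 0) := by
    obtain ⟨Q, x', y', z'⟩ := w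
    rw [adjMatrix_apply]
    simp only [pawGraph, Prod.mk.injEq]
    fin_cases Q <;> simp <;> grind
  simp only [e, Finset.sum_add_distrib, Finset.sum_sub_distrib, Finset.sum_ite_eq',
    Finset.mem_univ, if_true]
  simp [Fintype.sum_prod_type]

lemma pawGraph_row_two : ∑ w, (pawGraph X Y Z).adjMatrix ℝ (2, x, y, z) w * a w =
    a (0, x, y, z) + a (1, x, y, z) + (∑ y', a (2, x, y', z) - a (2, x, y, z)) := by
  have e (w : Fin 4 × X × Y × Z) : (pawGraph X Y Z).adjMatrix ℝ (2, x, y, z) w * a w =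
      (if w = (0, x, y, z) then a w else 0) + (if w = (1, x, y, z) then a w else 0) +
      ((if w.1 = 2 then if w.2.1 = x then if w.2.2.2 = z then a w else 0 else 0 else 0) -
        if w = (2, x, y, z) then a w else 0) := by
    obtain ⟨Q, x', y', z'⟩ := w
    rw [adjMatrix_apply]
    simp only [pawGraph, Prod.mk.injEq]
    fin_cases Q <;> simp <;> grind
  simp only [e, Finset.sum_add_distrib, Finset.sum_sub_distrib, Finset.sum_ite_eq',
    Finset.mem_univ, if_true]
  simp [Fintype.sum_prod_type]

lemma pawGraph_row_three : ∑ w, (pawGraph X Y Z).adjMatrix ℝ (3, x, y, z) w * a w =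
    a (0, x, y, z) + (∑ z', a (3, x, y, z') - a (3, x, y, z)) := by
  have e (w : Fin 4 × X × Y × Z) : (pawGraph X Y Z).adjMatrix ℝ (3, x, y, z) w * a w =
      (if w = (0, x, y, z) then a w else 0) +
      ((if w.1 = 3 then if w.2.1 = x then if w.2.2.1 = y then a w else 0 else 0 else 0) -
        if w = (3, x, y, z) then a w else 0) := by
    obtain ⟨Q, x', y', z'⟩ := w
    rw [adjMatrix_apply]
    simp only [pawGraph, Prod.mk.injEq]
    fin_cases Q <;> simp <;> grind
  simp only [e, Finset.sum_add_distrib, Finset.sum_sub_distrib, Finset.sum_ite_eq',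
    Finset.mem_univ, if_true]
  simp [Fintype.sum_prod_type, Finset.sum_comm (γ := Y)]

lemma sum_pawGraph (g : Fin 4 × X × Y × Z → ℝ) : ∑ v, g v =
    ∑ x, ∑ y, ∑ z, (g (0, x, y, z) + g (1, x, y, z) + g (2, x, y, z) + g (3, x, y, z)) := by
  simp only [Fintype.sum_prod_type, Fin.sum_univ_four, Finset.sum_add_distrib]

lemma pawGraph_isRegularOfDegree {k : ℕ} (hX : Fintype.card X + 2 = k)
    (hY : Fintype.card Y + 1 = k) (hZ : Fintype.card Z = k) :
    (pawGraph X Y Z).IsRegularOfDegree k := by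
  rintro ⟨P, x, y, z⟩
  have hX' : (Fintype.card X : ℝ) + 2 = k := by exact_mod_cast hX
  have hY' : (Fintype.card Y : ℝ) + 1 = k := by exact_mod_cast hY
  have h := (pawGraph X Y Z).adjMatrix_mulVec_const_apply (α := ℝ) (a := 1) (v := (P, x, y, z))
  simp only [Matrix.mulVec, dotProduct, Function.const_apply, mul_one] at h
  have h0 := pawGraph_row_zero (fun _ => 1) x y z
  have h1 := pawGraph_row_one (fun _ => 1) x y z
  have h2 := pawGraph_row_two (fun _ => 1) x y z
  have h3 := pawGraph_row_three (fun _ => 1) x y z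
  simp only [mul_one, Finset.sum_const, Finset.card_univ, nsmul_eq_mul] at h0 h1 h2 h3
  have : ((pawGraph X Y Z).degree (P, x, y, z) : ℝ) = k := by
    rw [← h]
    fin_cases P
    · exact h0.trans (by linarith)
    · exact h1.trans (by linarith)
    · exact h2.trans (by linarith)
    · exact h3.trans (by rw [hZ]; ring)
  exact_mod_cast this

lemma paw_form_nonneg {μ : ℝ} (hμ : μ ^ 3 + μ ^ 2 - 3 * μ - 1 = 0) (hμ1 : 1 < μ)
    (c u v p : ℝ) :
    0 ≤ μ * (c ^ 2 + u ^ 2 + v ^ 2 + p ^ 2) + 2 * c * (u + v + p) + 2 * u * v := by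
  have hμ0 : μ ≠ 0 := by positivity
  have e : μ * (c ^ 2 + u ^ 2 + v ^ 2 + p ^ 2) + 2 * c * (u + v + p) + 2 * u * v =
      μ * (p + c / μ) ^ 2 + (μ - 1) / 2 * (u - v) ^ 2 +
        (μ + 1) / 2 * (u + v + 2 * c / (μ + 1)) ^ 2 := by
    have hμ2 : μ + 1 ≠ 0 := by positivity
    field_simp
    linear_combination (2 * c ^ 2) * hμ
  rw [e]
  have : 0 ≤ μ - 1 := by linarith
  positivity

lemma sum_sum_mul_sum_nonneg {I J : Type} [Fintype I] [Fintype J] (g : I → J → ℝ) :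
    0 ≤ ∑ i, ∑ j, g i j * ∑ j', g i j' := by
  simp only [← Finset.sum_mul]
  exact Finset.sum_nonneg fun i _ => mul_self_nonneg _

lemma le_lambdaMin_pawGraph [Nonempty X] [Nonempty Y] [Nonempty Z] {μ : ℝ}
    (hμ : μ ^ 3 + μ ^ 2 - 3 * μ - 1 = 0) (hμ1 : 1 < μ) :
    -(μ + 1) ≤ lambdaMin (pawGraph X Y Z) := by
  refine le_lambdaMin_of_forall fun a => ?_
  have e (v : Fin 4 × X × Y × Z) : ∑ w, a v * a w * (pawGraph X Y Z).adjMatrix ℝ v w =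
      a v * ∑ w, (pawGraph X Y Z).adjMatrix ℝ v w * a w := by
    rw [Finset.mul_sum]
    exact Finset.sum_congr rfl fun w _ => by ring
  simp only [e]
  rw [sum_pawGraph, sum_pawGraph]
  simp only [pawGraph_row_zero, pawGraph_row_one, pawGraph_row_two, pawGraph_row_three]
  have n0 : 0 ≤ ∑ x, ∑ y, ∑ z, a (0, x, y, z) * ∑ x', a (0, x', y, z) := by
    have h := sum_sum_mul_sum_nonneg fun (i : Y × Z) (x : X) => a (0, x, i.1, i.2)
    rw [Finset.sum_comm] at h
    simpa only [Fintype.sum_prod_type] using h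
  have n1 (P : Fin 4) : 0 ≤ ∑ x, ∑ y, ∑ z, a (P, x, y, z) * ∑ y', a (P, x, y', z) :=
    Finset.sum_nonneg fun x _ => by
      rw [Finset.sum_comm]
      exact sum_sum_mul_sum_nonneg fun z y => a (P, x, y, z)
  have n3 : 0 ≤ ∑ x, ∑ y, ∑ z, a (3, x, y, z) * ∑ z', a (3, x, y, z') :=
    Finset.sum_nonneg fun x _ => sum_sum_mul_sum_nonneg fun y z => a (3, x, y, z)
  have n : 0 ≤ ∑ x, ∑ y, ∑ z, (μ * (a (0, x, y, z) ^ 2 + a (1, x, y, z) ^ 2 +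
      a (2, x, y, z) ^ 2 + a (3, x, y, z) ^ 2) +
      2 * a (0, x, y, z) * (a (1, x, y, z) + a (2, x, y, z) + a (3, x, y, z)) +
      2 * a (1, x, y, z) * a (2, x, y, z)) :=
    Finset.sum_nonneg fun x _ => Finset.sum_nonneg fun y _ => Finset.sum_nonneg fun z _ =>
      paw_form_nonneg hμ hμ1 _ _ _ _
  have key := add_nonneg (add_nonneg (add_nonneg (add_nonneg n n0) (n1 1)) (n1 2)) n3
  rw [← sub_nonneg]
  refine key.trans_eq ?_
  simp only [Finset.mul_sum (Finset.univ : Finset X) _ (-(μ + 1)),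
    Finset.mul_sum (Finset.univ : Finset Y) _ (-(μ + 1)),
    Finset.mul_sum (Finset.univ : Finset Z) _ (-(μ + 1)), ← Finset.sum_add_distrib,
    ← Finset.sum_sub_distrib]
  refine Finset.sum_congr rfl fun x _ => Finset.sum_congr rfl fun y _ =>
    Finset.sum_congr rfl fun z _ => ?_
  ring

lemma lambdaMin_pawGraph_le {μ : ℝ} (hμ : μ ^ 3 + μ ^ 2 - 3 * μ - 1 = 0) (hμ1 : 1 < μ)
    {f : X → ℝ} {g : Y → ℝ} {h : Z → ℝ} (hf : ∑ x, f x = 0) (hg : ∑ y, g y = 0)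
    (hh : ∑ z, h z = 0) (hf0 : f ≠ 0) (hg0 : g ≠ 0) (hh0 : h ≠ 0) :
    lambdaMin (pawGraph X Y Z) ≤ -(μ + 1) := by
  let b : Fin 4 → ℝ := ![μ * (μ + 1), -μ, -μ, -(μ + 1)]
  let a : Fin 4 × X × Y × Z → ℝ := fun v => b v.1 * (f v.2.1 * g v.2.2.1 * h v.2.2.2)
  have ha (v) : ∑ w, (pawGraph X Y Z).adjMatrix ℝ v w * a w = -(μ + 1) * a v := by
    obtain ⟨P, x, y, z⟩ := v
    fin_cases P
    · refine (pawGraph_row_zero a x y z).trans ?_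
      simp only [a, ← Finset.sum_mul, ← Finset.mul_sum, hf]
      simp [b]
      linear_combination f x * g y * h z * hμ
    · refine (pawGraph_row_one a x y z).trans ?_
      simp only [a, ← Finset.sum_mul, ← Finset.mul_sum, hg]
      simp [b]
      ring
    · refine (pawGraph_row_two a x y z).trans ?_
      simp only [a, ← Finset.sum_mul, ← Finset.mul_sum, hg]
      simp [b]
      ring
    · refine (pawGraph_row_three a x y z).trans ?_
      simp only [a, ← Finset.mul_sum, hh]
      simp [b]
      ring
  have hle := lambdaMin_mul_le (pawGraph X Y Z) a
  have e : ∑ v, ∑ w, a v * a w * (pawGraph X Y Z).adjMatrix ℝ v w =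
      -(μ + 1) * ∑ v, a v ^ 2 := by
    rw [Finset.mul_sum]
    refine Finset.sum_congr rfl fun v _ => ?_
    calc _ = a v * ∑ w, (pawGraph X Y Z).adjMatrix ℝ v w * a w := by
          rw [Finset.mul_sum]; exact Finset.sum_congr rfl fun w _ => by ring
      _ = _ := by rw [ha]; ring
  rw [e] at hle
  refine le_of_mul_le_mul_right hle ?_
  obtain ⟨x, hx⟩ := Function.ne_iff.1 hf0
  obtain ⟨y, hy⟩ := Function.ne_iff.1 hg0
  obtain ⟨z, hz⟩ := Function.ne_iff.1 hh0
  simp only [Pi.zero_apply] at hx hy hz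
  refine Finset.sum_pos' (fun v _ => sq_nonneg _) ⟨(0, x, y, z), Finset.mem_univ _, ?_⟩
  have : b 0 ≠ 0 := by simp only [b, Matrix.cons_val_zero]; positivity
  simp only [a]
  positivity

end PawGraph

lemma exists_sum_eq_zero_ne_zero (n : ℕ) : ∃ f : Fin (n + 2) → ℝ, ∑ i, f i = 0 ∧ f ≠ 0 := by
  refine ⟨Pi.single 0 1 - Pi.single 1 1, by simp, fun h => ?_⟩
  simpa using congrFun h 0

lemma exists_regular_lambdaMin_eq {μ : ℝ} (hμ : μ ^ 3 + μ ^ 2 - 3 * μ - 1 = 0) (hμ1 : 1 < μ)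
    {k : ℕ} (hk : 4 ≤ k) : ∃ (n : ℕ) (G : SimpleGraph (Fin n)), G.Connected ∧
      G.IsRegularOfDegree k ∧ lambdaMin G = -(μ + 1) := by
  obtain ⟨m, rfl⟩ := Nat.exists_eq_add_of_le' hk
  obtain ⟨f, hf, hf0⟩ := exists_sum_eq_zero_ne_zero m
  obtain ⟨g, hg, hg0⟩ := exists_sum_eq_zero_ne_zero (m + 1)
  obtain ⟨h, hh, hh0⟩ := exists_sum_eq_zero_ne_zero (m + 2)
  set H := pawGraph (Fin (m + 2)) (Fin (m + 1 + 2)) (Fin (m + 2 + 2))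
  have e := Iso.map (Fintype.equivFin _) H
  refine ⟨_, H.map (Fintype.equivFin _), e.connected_iff.1 pawGraph_connected, ?_, ?_⟩
  · have hH : H.IsRegularOfDegree (m + 4) := pawGraph_isRegularOfDegree (by simp) (by simp) (by simp)
    intro v
    convert (e.symm.degree_eq v).symm.trans (hH (e.symm v))
  · rw [← lambdaMin_eq_of_iso e]
    exact le_antisymm (lambdaMin_pawGraph_le hμ hμ1 hf hg hh hf0 hg0 hh0)
      (le_lambdaMin_pawGraph hμ hμ1)

lemma root_bounds {α : ℝ} (hα : IsLeast {x : ℝ | x ^ 3 + 2 * x ^ 2 - 2 * x - 2 = 0} α) :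
    -(5 / 2) ≤ α ∧ α < -1 - Real.sqrt 2 := by
  have h2 : Real.sqrt 2 ^ 2 = 2 := Real.sq_sqrt (by norm_num)
  have h1 : 1 < Real.sqrt 2 := by rw [Real.lt_sqrt] <;> norm_num
  have h3 : Real.sqrt 2 < 3 / 2 := by rw [Real.sqrt_lt'] <;> norm_num
  constructor
  · have h := hα.1
    simp only [Set.mem_ofPred_eq] at h
    by_contra! hlt
    nlinarith [mul_pos (sub_pos.2 hlt) (sub_pos.2 hlt), sq_nonneg α,
      mul_nonneg (sub_pos.2 hlt).le (sq_nonneg α)]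
  · have hc : ContinuousOn (fun x : ℝ => x ^ 3 + 2 * x ^ 2 - 2 * x - 2)
        (Set.Icc (-(5 / 2)) (-1 - Real.sqrt 2)) := by fun_prop
    obtain ⟨x, hx, hx0⟩ := intermediate_value_Ico (by linarith) hc
      (show (0 : ℝ) ∈ Set.Ico _ _ from ⟨by norm_num, by
        have : (-1 - Real.sqrt 2) ^ 3 + 2 * (-1 - Real.sqrt 2) ^ 2 - 2 * (-1 - Real.sqrt 2) - 2 =
          Real.sqrt 2 - 1 := by linear_combination (-1 - Real.sqrt 2) * h2
        simp only [this]
        linarith⟩)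
    exact (hα.2 hx0).trans_lt hx.2

/-- There is `N` such that for `k ≥ N` there are connected `k`-regular graphs with
`λmin < -1-√2`, and `ξ̂_k`, the supremum of `λmin` over this collection, tends to `α₁`,
the smallest real root of `x³+2x²-2x-2`, as `k → ∞`. -/
theorem stmt_4 (α₁ : ℝ) (hα₁ : IsLeast {x : ℝ | x ^ 3 + 2 * x ^ 2 - 2 * x - 2 = 0} α₁) :
    ∃ N : ℕ,
      (∀ k : ℕ, N ≤ k →
        {x : ℝ | ∃ (n : ℕ) (G : SimpleGraph (Fin n)), G.Connected ∧ G.IsRegularOfDegree k ∧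
          lambdaMin G < -1 - Real.sqrt 2 ∧ lambdaMin G = x}.Nonempty) ∧
      Tendsto (fun k : ℕ =>
          sSup {x : ℝ | ∃ (n : ℕ) (G : SimpleGraph (Fin n)), G.Connected ∧
            G.IsRegularOfDegree k ∧ lambdaMin G < -1 - Real.sqrt 2 ∧ lambdaMin G = x})
        atTop (nhds α₁) := by
  obtain ⟨hα, hα'⟩ := root_bounds hα₁
  have hroot : α₁ ^ 3 + 2 * α₁ ^ 2 - 2 * α₁ - 2 = 0 := hα₁.1
  have h1 : 1 < Real.sqrt 2 := by rw [Real.lt_sqrt] <;> norm_num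
  obtain ⟨μ, rfl⟩ : ∃ μ, α₁ = -(μ + 1) := ⟨-(α₁ + 1), by ring⟩
  have hμ : μ ^ 3 + μ ^ 2 - 3 * μ - 1 = 0 := by linear_combination -hroot
  have hmem (k : ℕ) (hk : 4 ≤ k) : -(μ + 1) ∈ {x : ℝ | ∃ (n : ℕ) (G : SimpleGraph (Fin n)),
      G.Connected ∧ G.IsRegularOfDegree k ∧ lambdaMin G < -1 - Real.sqrt 2 ∧ lambdaMin G = x} := by
    obtain ⟨n, G, hG, hGk, hGμ⟩ := exists_regular_lambdaMin_eq hμ (by linarith) hk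
    exact ⟨n, G, hG, hGk, hGμ ▸ hα', hGμ⟩
  refine ⟨4, fun k hk => ⟨_, hmem k hk⟩, Metric.tendsto_atTop.2 fun ε hε => ?_⟩
  obtain ⟨K, hK⟩ := exists_degree_bound hμ (by linarith) (by linarith)
    (show μ + 1 - ε / 2 < μ + 1 by linarith)
  refine ⟨max 4 K, fun k hk => ?_⟩
  have hk4 := (le_max_left _ _).trans hk
  have hle : -(μ + 1) ≤ sSup _ := le_csSup ⟨-1 - Real.sqrt 2, by
    rintro _ ⟨n, G, -, -, hG, rfl⟩; exact hG.le⟩ (hmem k hk4)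
  have hge := csSup_le (a := -(μ + 1 - ε / 2)) ⟨_, hmem k hk4⟩ (by
    rintro _ ⟨n, G, hG, hGk, hlt, rfl⟩
    by_contra! hcon
    have := hG.nonempty
    refine hlt.not_ge (hK G (fun v => ?_) hcon.le)
    rw [← neighborFinset_eq_filter, card_neighborFinset_eq_degree, hGk v]
    exact (le_max_right _ _).trans hk)
  rw [Real.dist_eq, abs_lt]
  constructor <;> linarith
end

section
/- For each integer k ≥ 1, let θ̂_k be the supremum of λmin(G) over all connected finite simple graphs G with minimum degree at least k and λmin(G) < −2. Then the sequence (θ̂_k) is nonincreasing in k and its limit as k → ∞ equals −1−√2. -/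
open SimpleGraph Filter

attribute [local instance] Classical.propDecidable

lemma le_lambdaMin_iff {V : Type} [Fintype V] [Nonempty V] (G : SimpleGraph V) (c : ℝ) :
    c ≤ lambdaMin G ↔
      ∀ x : V → ℝ, c * ∑ u, x u ^ 2 ≤ ∑ u, ∑ v, if G.Adj u v then x u * x v else 0 := by
  have hA := adjMatrix_isHermitian G
  have quad (x : V → ℝ) : x ⬝ᵥ (G.adjMatrix ℝ).mulVec x =
      ∑ u, ∑ v, if G.Adj u v then x u * x v else 0 := by
    simp [dotProduct, Matrix.mulVec, Finset.mul_sum, SimpleGraph.adjMatrix_apply]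
  have eig : c ≤ lambdaMin G ↔ ∀ i, c ≤ hA.eigenvalues i :=
    le_ciInf_iff (Set.finite_range _).bddBelow
  have herm : (G.adjMatrix ℝ - algebraMap ℝ (Matrix V V ℝ) c).IsHermitian := by
    refine hA.sub ?_
    rw [Matrix.algebraMap_eq_diagonal]
    exact Matrix.isHermitian_diagonal _
  have key : (G.adjMatrix ℝ - algebraMap ℝ (Matrix V V ℝ) c).PosSemidef ↔
      ∀ i, c ≤ hA.eigenvalues i := by
    open scoped MatrixOrder in
    rw [← Matrix.le_iff, algebraMap_le_iff_le_spectrum (a := G.adjMatrix ℝ) (ha := hA)]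
    rw [hA.spectrum_real_eq_range_eigenvalues]
    simp
  rw [eig, ← key, Matrix.posSemidef_iff_dotProduct_mulVec]
  simp only [herm, true_and]
  refine forall_congr' fun x ↦ ?_
  rw [star_trivial, Matrix.sub_mulVec, dotProduct_sub, quad, sub_nonneg]
  simp [Matrix.algebraMap_eq_diagonal, Matrix.mulVec_diagonal, dotProduct, Finset.mul_sum, pow_two,
    mul_left_comm]

lemma lambdaMin_le_of_iso {V W : Type} [Fintype V] [Fintype W] [Nonempty V] {G : SimpleGraph V}
    {H : SimpleGraph W} (φ : G ≃g H) : lambdaMin G ≤ lambdaMin H := by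
  have : Nonempty W := φ.toEquiv.symm.nonempty
  refine (le_lambdaMin_iff H _).2 fun y ↦ ?_
  have h := (le_lambdaMin_iff G _).1 le_rfl (y ∘ φ)
  simpa [← φ.toEquiv.sum_comp, φ.map_adj_iff] using h

lemma lambdaMin_congr {V W : Type} [Fintype V] [Fintype W] [Nonempty V] {G : SimpleGraph V}
    {H : SimpleGraph W} (φ : G ≃g H) : lambdaMin G = lambdaMin H :=
  have : Nonempty W := φ.toEquiv.symm.nonempty
  le_antisymm (lambdaMin_le_of_iso φ) (lambdaMin_le_of_iso φ.symm)

/-- Three disjoint copies of the complete graph on `m + 1` vertices, whose distinguished vertices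
`(0, 0)`, `(1, 0)`, `(2, 0)` are joined in a path. -/
def pathOfCliques (m : ℕ) : SimpleGraph (Fin 3 × Fin (m + 1)) where
  Adj u v := (u.1 = v.1 ∧ u.2 ≠ v.2) ∨
    (u.2 = 0 ∧ v.2 = 0 ∧ ((u.1 = 1 ∧ v.1 ≠ 1) ∨ (u.1 ≠ 1 ∧ v.1 = 1)))
  symm := ⟨by
    rintro ⟨i, a⟩ ⟨j, b⟩ h
    grind⟩
  loopless := ⟨by
    rintro ⟨i, a⟩ h
    grind⟩

lemma pathOfCliques_connected (m : ℕ) : (pathOfCliques m).Connected := by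
  have base (i : Fin 3) : (pathOfCliques m).Reachable (i, 0) (1, 0) := by
    by_cases hi : i = 1
    · rw [hi]
    · exact Adj.reachable (by simp [pathOfCliques, hi])
  have all (u : Fin 3 × Fin (m + 1)) : (pathOfCliques m).Reachable u (1, 0) := by
    refine Reachable.trans ?_ (base u.1)
    obtain ⟨i, a⟩ := u
    by_cases ha : a = 0
    · rw [ha]
    · exact Adj.reachable (by simp [pathOfCliques, ha])
  exact (connected_iff _).2 ⟨fun u v ↦ (all u).trans (all v).symm, ⟨(0, 0)⟩⟩

lemma le_degree_pathOfCliques (m : ℕ) (u : Fin 3 × Fin (m + 1)) :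
    m ≤ (pathOfCliques m).degree u := by
  calc m = ((Finset.univ.erase u.2).image (Prod.mk u.1)).card := by
        rw [Finset.card_image_of_injective _ (Prod.mk_right_injective _)]
        simp
    _ ≤ _ := by
        refine Finset.card_le_card fun v hv ↦ ?_
        simp only [Finset.mem_image, Finset.mem_erase, Finset.mem_univ, and_true] at hv
        obtain ⟨b, hb, rfl⟩ := hv
        rw [mem_neighborFinset]
        exact Or.inl ⟨rfl, hb.symm⟩

lemma pathOfCliques_quadratic (m : ℕ) (x : Fin 3 × Fin (m + 1) → ℝ) :
    (∑ u, ∑ v, if (pathOfCliques m).Adj u v then x u * x v else 0) =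
      ∑ i, (∑ a, x (i, a)) ^ 2 - ∑ u, x u ^ 2 + 2 * x (1, 0) * (x (0, 0) + x (2, 0)) := by
  have split (i j : Fin 3) (a b : Fin (m + 1)) :
      (if (pathOfCliques m).Adj (i, a) (j, b) then x (i, a) * x (j, b) else 0) =
      (if i = j then x (i, a) * x (j, b) else 0) -
      (if i = j then if a = b then x (i, a) * x (j, b) else 0 else 0) +
      (if a = 0 then if b = 0 then
        if (i = 1 ∧ j ≠ 1) ∨ (i ≠ 1 ∧ j = 1) then x (i, a) * x (j, b) else 0 else 0 else 0) := by
    by_cases hij : i = j <;> by_cases hab : a = b <;> by_cases ha : a = 0 <;>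
      by_cases hb : b = 0 <;> simp [pathOfCliques, *] <;> grind
  simp only [Fintype.sum_prod_type, split, Finset.sum_add_distrib, Finset.sum_sub_distrib]
  congr 1
  · congr 1
    · simp only [Finset.sum_ite_irrel, Finset.sum_const_zero]
      refine Finset.sum_congr rfl fun i _ ↦ ?_
      simp [sq, Finset.sum_mul_sum]
    · simp [sq, Finset.sum_ite_irrel]
  · simp [Finset.sum_ite_irrel, Fin.sum_univ_three]
    ring

lemma le_lambdaMin_pathOfCliques (m : ℕ) : -1 - √2 ≤ lambdaMin (pathOfCliques m) := by
  rw [le_lambdaMin_iff]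
  intro x
  rw [pathOfCliques_quadratic]
  have h1 : 0 ≤ ∑ i, (∑ a, x (i, a)) ^ 2 := Finset.sum_nonneg fun _ _ ↦ sq_nonneg _
  have h2 : x (0, 0) ^ 2 + x (1, 0) ^ 2 + x (2, 0) ^ 2 ≤ ∑ u, x u ^ 2 := by
    rw [Fintype.sum_prod_type, Fin.sum_univ_three]
    gcongr <;> exact Finset.single_le_sum (f := fun a ↦ x (_, a) ^ 2)
      (fun _ _ ↦ sq_nonneg _) (Finset.mem_univ 0)
  have h3 : √2 * √2 = 2 := Real.mul_self_sqrt (by norm_num)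
  have h4 := mul_le_mul_of_nonneg_left h2 (Real.sqrt_nonneg 2)
  have h5 : √2 * (√2 * x (1, 0) + (x (0, 0) + x (2, 0))) ^ 2 = 2 * √2 * x (1, 0) ^ 2 +
      4 * x (1, 0) * (x (0, 0) + x (2, 0)) + √2 * (x (0, 0) + x (2, 0)) ^ 2 := by
    linear_combination (√2 * x (1, 0) ^ 2 + 2 * x (1, 0) * (x (0, 0) + x (2, 0))) * h3
  nlinarith [mul_nonneg (Real.sqrt_nonneg 2)
      (sq_nonneg (√2 * x (1, 0) + (x (0, 0) + x (2, 0)))),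
    mul_nonneg (Real.sqrt_nonneg 2) (sq_nonneg (x (0, 0) - x (2, 0)))]

lemma lambdaMin_pathOfCliques_lt {m : ℕ} (hm : 4 ≤ m) : lambdaMin (pathOfCliques m) < -2 := by
  by_contra! h
  rw [le_lambdaMin_iff] at h
  have hm' : (4 : ℝ) ≤ m := by exact_mod_cast hm
  specialize h fun u ↦ (if u.2 = 0 then (m : ℝ) else -1) * if u.1 = 1 then -1 else 1
  rw [pathOfCliques_quadratic] at h
  simp [Fintype.sum_prod_type, Fin.sum_univ_succ] at h
  nlinarith

lemma exists_connected_lambdaMin_lt (k : ℕ) :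
    ∃ (n : ℕ) (G : SimpleGraph (Fin n)), G.Connected ∧ (∀ v : Fin n, k ≤ G.degree v) ∧
      lambdaMin G < -2 ∧ -1 - √2 ≤ lambdaMin G := by
  set H := pathOfCliques (k + 4)
  let φ := H.overFinIso rfl
  refine ⟨_, H.overFin rfl, φ.connected_iff.1 (pathOfCliques_connected _), fun v ↦ ?_, ?_, ?_⟩
  · rw [← φ.symm.degree_eq]
    exact (Nat.le_add_right k 4).trans (le_degree_pathOfCliques _ _)
  · rw [← lambdaMin_congr φ]
    exact lambdaMin_pathOfCliques_lt (by omega)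
  · rw [← lambdaMin_congr φ]
    exact le_lambdaMin_pathOfCliques _

lemma exists_ramsey (r s : ℕ) : ∃ N, ∀ {V : Type} (G : SimpleGraph V) (T : Finset V), N ≤ T.card →
    (∃ Q ⊆ T, G.IsNClique r Q) ∨ ∃ I ⊆ T, Gᶜ.IsNClique s I := by
  induction r generalizing s with
  | zero => exact ⟨0, fun G T _ ↦ .inl ⟨∅, by simp⟩⟩
  | succ r ihr =>
    induction s with
    | zero => exact ⟨0, fun G T _ ↦ .inr ⟨∅, by simp⟩⟩
    | succ s ihs =>
      obtain ⟨a, ha⟩ := ihr (s + 1)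
      obtain ⟨b, hb⟩ := ihs
      refine ⟨a + b + 1, fun G T hT ↦ ?_⟩
      obtain ⟨v, hv⟩ : T.Nonempty := Finset.card_pos.1 (by omega)
      have hsplit := Finset.card_filter_add_card_filter_not (s := T.erase v) (fun w ↦ G.Adj v w)
      rw [Finset.card_erase_of_mem hv] at hsplit
      have sub (p : _ → Prop) [DecidablePred p] : (T.erase v).filter p ⊆ T :=
        (Finset.filter_subset _ _).trans (Finset.erase_subset _ _)
      obtain h | h : a ≤ ((T.erase v).filter fun w ↦ G.Adj v w).card ∨
          b ≤ ((T.erase v).filter fun w ↦ ¬ G.Adj v w).card := by omega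
      · obtain ⟨Q, hQ, hc⟩ | ⟨I, hI, hc⟩ := ha G _ h
        · refine .inl ⟨insert v Q, Finset.insert_subset hv (hQ.trans (sub _)), hc.insert ?_⟩
          exact fun w hw ↦ (Finset.mem_filter.1 (hQ hw)).2
        · exact .inr ⟨I, hI.trans (sub _), hc⟩
      · obtain ⟨Q, hQ, hc⟩ | ⟨I, hI, hc⟩ := hb G _ h
        · exact .inl ⟨Q, hQ.trans (sub _), hc⟩
        · refine .inr ⟨insert v I, Finset.insert_subset hv (hI.trans (sub _)), hc.insert ?_⟩
          intro w hw
          have := Finset.mem_filter.1 (hI hw)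
          exact ⟨(Finset.ne_of_mem_erase this.1).symm, this.2⟩

/-- A representation of `A(G) + L • 1` as the Gram matrix of vectors `e v` with respect to a
positive semidefinite form, for some `2 ≤ L < 1 + √2`. -/
structure IsGramRep {V H : Type} [AddCommGroup H] [Module ℝ H] (G : SimpleGraph V) (L : ℝ)
    (B : LinearMap.BilinForm ℝ H) (e : V → H) : Prop where
  nonneg : ∀ x, 0 ≤ B x x
  comm : ∀ x y, B x y = B y x
  gram : ∀ u v, B (e u) (e v) = if u = v then L else if G.Adj u v then 1 else 0
  two_le : 2 ≤ L
  lt : L < 1 + √2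

/-- The average of the vectors `e v` for `v ∈ Q`. -/
noncomputable def avg {V H : Type} [AddCommGroup H] [Module ℝ H] (e : V → H) (Q : Finset V) : H :=
  (Q.card : ℝ)⁻¹ • ∑ v ∈ Q, e v

namespace IsGramRep

variable {V H : Type} [AddCommGroup H] [Module ℝ H] {G : SimpleGraph V} {L : ℝ}
  {B : LinearMap.BilinForm ℝ H} {e : V → H}

lemma apply_avg (B : LinearMap.BilinForm ℝ H) (e : V → H) (x : H) (Q : Finset V) :
    B x (avg e Q) = (Q.card : ℝ)⁻¹ * ∑ v ∈ Q, B x (e v) := by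
  simp [avg]

lemma apply_avg_le {x : H} {Q : Finset V} (hQ : Q.Nonempty) {c : ℝ}
    (h : ∀ v ∈ Q, B x (e v) ≤ c) : B x (avg e Q) ≤ c := by
  have : (0 : ℝ) < Q.card := by exact_mod_cast hQ.card_pos
  rw [apply_avg, inv_mul_le_iff₀ this]
  simpa using Finset.sum_le_card_nsmul Q _ c h

lemma le_apply_avg {x : H} {Q : Finset V} (hQ : Q.Nonempty) {c : ℝ}
    (h : ∀ v ∈ Q, c ≤ B x (e v)) : c ≤ B x (avg e Q) := by
  have : (0 : ℝ) < Q.card := by exact_mod_cast hQ.card_pos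
  rw [apply_avg, le_inv_mul_iff₀ this]
  simpa using Finset.card_nsmul_le_sum Q _ c h

lemma lt_rat (h : IsGramRep G L B e) : L < 2.4143 := by
  have : √2 < 1.4143 := by rw [Real.sqrt_lt' (by norm_num)]; norm_num
  linarith [h.lt]

lemma gram_nonneg (h : IsGramRep G L B e) (u v : V) : 0 ≤ B (e u) (e v) := by
  rw [h.gram]
  split_ifs <;> linarith [h.two_le]

lemma gram_le (h : IsGramRep G L B e) (u v : V) : B (e u) (e v) ≤ 3 := by
  rw [h.gram]
  split_ifs <;> linarith [h.lt_rat]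

lemma cauchy_schwarz (h : IsGramRep G L B e) (x y : H) : B x y ^ 2 ≤ B x x * B y y :=
  LinearMap.BilinForm.apply_sq_le_of_symm B h.nonneg ⟨h.comm⟩ x y

/-- Stars `K_{1,6}` do not occur. -/
lemma no_independent_six (h : IsGramRep G L B e) {v : V} {I : Finset V}
    (hI : Gᶜ.IsNClique 6 I) (hv : ∀ u ∈ I, G.Adj v u) : False := by
  have h1 : B (e v) (∑ u ∈ I, e u) = 6 := by
    rw [map_sum, Finset.sum_congr rfl (g := fun _ ↦ (1 : ℝ))]
    · simp [hI.card_eq]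
    · intro u hu
      rw [h.gram, if_neg (hv u hu).ne, if_pos (hv u hu)]
  have h2 : B (∑ u ∈ I, e u) (∑ u ∈ I, e u) = 6 * L := by
    simp only [map_sum, LinearMap.sum_apply]
    rw [Finset.sum_congr rfl (g := fun _ ↦ L)]
    · simp [hI.card_eq]
    · intro u hu
      rw [Finset.sum_eq_single u, h.gram, if_pos rfl]
      · intro w hw hwu
        have := (compl_adj G w u).1 (hI.isClique hw hu hwu)
        rw [h.gram, if_neg hwu, if_neg this.2]
      · exact fun hu' ↦ (hu' hu).elim
  have h3 := h.cauchy_schwarz (e v) (∑ u ∈ I, e u)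
  rw [h1, h2, h.gram, if_pos rfl] at h3
  nlinarith [h.two_le, h.lt_rat]

lemma avg_avg_of_clique (h : IsGramRep G L B e) {Q R T : Finset V} (hQ : G.IsClique Q)
    (hR : R ⊆ Q) (hT : T ⊆ Q) (hR0 : R.Nonempty) (hT0 : T.Nonempty) :
    B (avg e R) (avg e T) = 1 + (L - 1) * (R ∩ T).card / (R.card * T.card) := by
  have hr : (R.card : ℝ) ≠ 0 := by exact_mod_cast hR0.card_pos.ne'
  have ht : (T.card : ℝ) ≠ 0 := by exact_mod_cast hT0.card_pos.ne'
  have h1 : ∑ u ∈ R, ∑ v ∈ T, B (e u) (e v) = R.card * T.card + (L - 1) * (R ∩ T).card := by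
    have h2 (u) (hu : u ∈ R) : ∑ v ∈ T, B (e u) (e v) = T.card + if u ∈ T then L - 1 else 0 := by
      rw [Finset.sum_congr rfl (g := fun v ↦ 1 + if u = v then L - 1 else 0)]
      · simp [Finset.sum_add_distrib]
      · intro v hv
        rw [h.gram]
        by_cases huv : u = v
        · simp [huv]
        · simp [huv, hQ (hR hu) (hT hv) huv]
    rw [Finset.sum_congr rfl h2, Finset.sum_add_distrib, ← Finset.sum_filter,
      Finset.filter_mem_eq_inter]
    simp
    ring
  rw [h.comm, apply_avg]
  simp only [h.comm (avg e T), apply_avg]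
  rw [← Finset.mul_sum, h1]
  field_simp

lemma sq_le_of_clique_split (h : IsGramRep G L B e) {Q R T : Finset V} (hQ : G.IsClique Q)
    (hR : R ⊆ Q) (hT : T ⊆ Q) (hR0 : R.Nonempty) (hT0 : T.Nonempty) (hRT : Disjoint R T) (x : H) :
    (B x (avg e R) - B x (avg e T)) ^ 2 ≤
      B x x * ((L - 1) * ((R.card : ℝ)⁻¹ + (T.card : ℝ)⁻¹)) := by
  have hr : (R.card : ℝ) ≠ 0 := by exact_mod_cast hR0.card_pos.ne'
  have ht : (T.card : ℝ) ≠ 0 := by exact_mod_cast hT0.card_pos.ne'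
  have h1 := h.cauchy_schwarz x (avg e R - avg e T)
  convert h1 using 2
  · rw [map_sub]
  · simp only [map_sub, LinearMap.sub_apply]
    rw [h.avg_avg_of_clique hQ hR hR hR0 hR0, h.avg_avg_of_clique hQ hT hT hT0 hT0,
      h.avg_avg_of_clique hQ hR hT hR0 hT0, h.avg_avg_of_clique hQ hT hR hT0 hR0,
      Finset.disjoint_iff_inter_eq_empty.1 hRT, Finset.disjoint_iff_inter_eq_empty.1 hRT.symm]
    simp
    field_simp

/-- If `B x` separates the vertices of a clique into those with values `≥ b` and those with values
`≤ l`, then all but at most seven vertices lie on the same side. -/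
lemma card_le_seven (h : IsGramRep G L B e) {Q : Finset V} (hQ : G.IsClique Q) {x : H} {b l : ℝ}
    (hlb : l < b) (hx : B x x * (L - 1) < 4 * (b - l) ^ 2)
    (hv : ∀ v ∈ Q, b ≤ B x (e v) ∨ B x (e v) ≤ l) :
    (Q.filter fun v ↦ b ≤ B x (e v)).card ≤ 7 ∨ (Q.filter fun v ↦ ¬ b ≤ B x (e v)).card ≤ 7 := by
  by_contra hc
  rw [not_or, not_le, not_le] at hc
  have hR0 := Finset.card_pos.1 (Nat.zero_lt_of_lt hc.1)
  have hT0 := Finset.card_pos.1 (Nat.zero_lt_of_lt hc.2)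
  have h1 := h.sq_le_of_clique_split hQ (Finset.filter_subset _ _) (Finset.filter_subset _ _)
    hR0 hT0 (Finset.disjoint_filter_filter_not _ _ _) x
  have h2 := le_apply_avg hR0 fun v hv ↦ (Finset.mem_filter.1 hv).2
  have h3 : B x (avg e (Q.filter fun v ↦ ¬ b ≤ B x (e v))) ≤ l := apply_avg_le hT0 fun v hv' ↦
    have := Finset.mem_filter.1 hv'
    (hv v this.1).resolve_left this.2
  have inv_le {n : ℕ} (hn : 7 < n) : (n : ℝ)⁻¹ ≤ 1 / 8 := by
    rw [one_div]
    gcongr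
    exact_mod_cast hn
  have h4 := inv_le hc.1
  have h5 := inv_le hc.2
  have h6 : 0 ≤ B x x * (L - 1) := mul_nonneg (h.nonneg x) (by linarith [h.two_le])
  have h7 := mul_le_mul_of_nonneg_left (add_le_add h4 h5) h6
  nlinarith

lemma avg_dichotomy (h : IsGramRep G L B e) {M : ℕ} (hM : 0 < M) {Q : Finset V}
    (hQ : G.IsNClique M Q) {x : H} {b l U : ℝ} (hl : 0 ≤ l) (hlb : l < b) (hb : b ≤ 1)
    (hx : B x x * (L - 1) < 4 * (b - l) ^ 2)
    (hv : ∀ v ∈ Q, b ≤ B x (e v) ∨ B x (e v) ≤ l)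
    (h0 : ∀ v ∈ Q, 0 ≤ B x (e v)) (hU : ∀ v ∈ Q, B x (e v) ≤ U) :
    B x (avg e Q) ≤ l + 7 * U / M ∨ b - 7 / M ≤ B x (avg e Q) := by
  have hM' : (0 : ℝ) < M := by exact_mod_cast hM
  have hsum := Finset.sum_filter_add_sum_filter_not Q (fun v ↦ b ≤ B x (e v)) fun v ↦ B x (e v)
  have hcard := Finset.card_filter_add_card_filter_not (s := Q) (fun v ↦ b ≤ B x (e v))
  rw [hQ.card_eq] at hcard
  have hcard' : ((Q.filter fun v ↦ b ≤ B x (e v)).card : ℝ) +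
      (Q.filter fun v ↦ ¬ b ≤ B x (e v)).card = M := by exact_mod_cast hcard
  obtain ⟨q, hq⟩ := Finset.card_pos.1 (hQ.card_eq ▸ hM)
  have hU0 : 0 ≤ U := (h0 q hq).trans (hU q hq)
  rw [apply_avg, hQ.card_eq]
  obtain hc | hc := h.card_le_seven hQ.isClique hlb hx hv
  · left
    have hc' : ((Q.filter fun v ↦ b ≤ B x (e v)).card : ℝ) ≤ 7 := by exact_mod_cast hc
    have h1 := Finset.sum_le_card_nsmul (Q.filter fun v ↦ b ≤ B x (e v)) (fun v ↦ B x (e v)) U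
      fun v hv ↦ hU v (Finset.mem_filter.1 hv).1
    have h2 := Finset.sum_le_card_nsmul (Q.filter fun v ↦ ¬ b ≤ B x (e v)) (fun v ↦ B x (e v)) l
      fun v hv' ↦ (hv v (Finset.mem_filter.1 hv').1).resolve_left (Finset.mem_filter.1 hv').2
    rw [nsmul_eq_mul] at h1 h2
    rw [inv_mul_le_iff₀ hM', mul_add, mul_div_cancel₀ _ hM'.ne']
    nlinarith
  · right
    have hc' : ((Q.filter fun v ↦ ¬ b ≤ B x (e v)).card : ℝ) ≤ 7 := by exact_mod_cast hc
    have h1 := Finset.card_nsmul_le_sum (Q.filter fun v ↦ b ≤ B x (e v)) (fun v ↦ B x (e v)) b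
      fun v hv ↦ (Finset.mem_filter.1 hv).2
    have h2 : 0 ≤ ∑ v ∈ Q.filter fun v ↦ ¬ b ≤ B x (e v), B x (e v) :=
      Finset.sum_nonneg fun v hv' ↦ h0 v (Finset.mem_filter.1 hv').1
    rw [nsmul_eq_mul] at h1
    rw [le_inv_mul_iff₀ hM', mul_sub, mul_div_cancel₀ _ hM'.ne']
    nlinarith

lemma vertex_dichotomy (h : IsGramRep G L B e) {M : ℕ} (hM : 1000 ≤ M) {Q : Finset V}
    (hQ : G.IsNClique M Q) (v : V) :
    B (e v) (avg e Q) ≤ 21 / M ∨ 1 - 7 / M ≤ B (e v) (avg e Q) := by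
  have h1 := h.avg_dichotomy (by omega) hQ (x := e v) (b := 1) (l := 0) (U := 3) le_rfl one_pos
    le_rfl ?_ ?_ (fun u _ ↦ h.gram_nonneg v u) (fun u _ ↦ h.gram_le v u)
  · rwa [zero_add, show (7 : ℝ) * 3 = 21 by norm_num] at h1
  · rw [h.gram, if_pos rfl]
    nlinarith [h.two_le, h.lt_rat]
  · intro u _
    rw [h.gram]
    split_ifs
    · exact .inl (by linarith [h.two_le])
    · exact .inl le_rfl
    · exact .inr le_rfl

lemma vertex_avg_nonneg (h : IsGramRep G L B e) {Q : Finset V} (hQ : Q.Nonempty) (v : V) :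
    0 ≤ B (e v) (avg e Q) :=
  le_apply_avg hQ fun _ _ ↦ h.gram_nonneg _ _

lemma vertex_avg_le (h : IsGramRep G L B e) {M : ℕ} (hM : 0 < M) {Q : Finset V}
    (hQ : G.IsNClique M Q) (v : V) : B (e v) (avg e Q) ≤ 1 + 2 / M := by
  have hM' : (0 : ℝ) < M := by exact_mod_cast hM
  rw [apply_avg, hQ.card_eq, inv_mul_le_iff₀ hM']
  calc ∑ u ∈ Q, B (e v) (e u) ≤ ∑ u ∈ Q, (1 + if v = u then (2 : ℝ) else 0) := by
        refine Finset.sum_le_sum fun u _ ↦ ?_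
        rw [h.gram]
        split_ifs <;> linarith [h.lt_rat]
    _ ≤ M + 2 := by
        rw [Finset.sum_add_distrib, Finset.sum_ite_eq]
        split_ifs <;> simp [hQ.card_eq]
    _ = M * (1 + 2 / M) := by field_simp

lemma avg_avg_nonneg (h : IsGramRep G L B e) {Q R : Finset V} (hQ : Q.Nonempty)
    (hR : R.Nonempty) : 0 ≤ B (avg e Q) (avg e R) :=
  le_apply_avg hR fun v _ ↦ by
    rw [h.comm]
    exact h.vertex_avg_nonneg hQ v

lemma avg_self (h : IsGramRep G L B e) {M : ℕ} (hM : 0 < M) {Q : Finset V}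
    (hQ : G.IsNClique M Q) : B (avg e Q) (avg e Q) = 1 + (L - 1) / M := by
  have hM' : (0 : ℝ) < M := by exact_mod_cast hM
  have hne : Q.Nonempty := Finset.card_pos.1 (hQ.card_eq ▸ hM)
  rw [h.avg_avg_of_clique hQ.isClique subset_rfl subset_rfl hne hne, Finset.inter_self, hQ.card_eq]
  field_simp

lemma avg_mem (h : IsGramRep G L B e) {M : ℕ} {Q : Finset V}
    (hQ : G.IsNClique M Q) {v : V} (hv : v ∈ Q) : B (e v) (avg e Q) = 1 + (L - 1) / M := by
  have := h.avg_avg_of_clique hQ.isClique (Finset.singleton_subset_iff.2 hv) subset_rfl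
    (Finset.singleton_nonempty v) ⟨v, hv⟩
  simpa [avg, Finset.singleton_inter_of_mem hv, hQ.card_eq] using this

lemma clique_dichotomy (h : IsGramRep G L B e) {M : ℕ} (hM : 1000 ≤ M) {Q R : Finset V}
    (hQ : G.IsNClique M Q) (hR : G.IsNClique M R) :
    B (avg e Q) (avg e R) ≤ 35 / M ∨ 1 - 35 / M ≤ B (avg e Q) (avg e R) := by
  have hM0 : 0 < M := by omega
  have hne : Q.Nonempty := Finset.card_pos.1 (hQ.card_eq ▸ hM0)
  have hM' : (1000 : ℝ) ≤ M := by exact_mod_cast hM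
  have hinv : (M : ℝ)⁻¹ ≤ 1 / 1000 := by
    rw [one_div]
    gcongr
  have hinv0 : 0 < (M : ℝ)⁻¹ := by positivity
  have h1 := h.avg_dichotomy hM0 hR (x := avg e Q) (b := 1 - 7 / M) (l := 21 / M) (U := 2)
    (by positivity) ?_ ?_ ?_ (fun v _ ↦ ?_) (fun v _ ↦ ?_) (fun v _ ↦ ?_)
  · simp only [div_eq_mul_inv] at h1 ⊢
    exact h1.imp (fun _ ↦ by linarith) fun _ ↦ by linarith
  · simp only [div_eq_mul_inv]
    linarith
  · simp only [div_eq_mul_inv]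
    linarith
  · rw [h.avg_self hM0 hQ]
    simp only [div_eq_mul_inv]
    generalize (M : ℝ)⁻¹ = t at hinv hinv0
    nlinarith [h.two_le, h.lt_rat, mul_pos hinv0 (sub_pos.2 h.lt_rat)]
  · rw [h.comm]
    exact (h.vertex_dichotomy hM hQ v).symm
  · rw [h.comm]
    exact h.vertex_avg_nonneg hne v
  · rw [h.comm]
    refine (h.vertex_avg_le hM0 hQ v).trans ?_
    simp only [div_eq_mul_inv]
    linarith

/-- If every vertex lies in a clique of size `M`, there is a family of `M`-cliques whose averages
are nearly orthonormal and such that every vertex is nearly completely joined to one of them. -/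
lemma exists_clique_family [Finite V] (h : IsGramRep G L B e) {M : ℕ} (hM : 1000 ≤ M)
    (hcov : ∀ v, ∃ Q, G.IsNClique M Q ∧ v ∈ Q) :
    ∃ (F : Finset (Finset V)) (C : V → Finset V → Prop),
      (∀ f ∈ F, ∀ g ∈ F, |B (avg e f) (avg e g) - if f = g then 1 else 0| ≤ 35 / M) ∧
      (∀ v, ∀ f ∈ F, |B (e v) (avg e f) - if C v f then 1 else 0| ≤ 35 / M) ∧
      ∀ v, ∃ f ∈ F, C v f := by
  have hM0 : 0 < M := by omega
  have hM' : (1000 : ℝ) ≤ M := by exact_mod_cast hM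
  have hinv : (M : ℝ)⁻¹ ≤ 1 / 1000 := by
    rw [one_div]
    gcongr
  have hinv0 : 0 < (M : ℝ)⁻¹ := by positivity
  have hne {Q : Finset V} (hQ : G.IsNClique M Q) : Q.Nonempty :=
    Finset.card_pos.1 (hQ.card_eq ▸ hM0)
  obtain ⟨F, hF⟩ := (Set.toFinite {F : Finset (Finset V) | (∀ f ∈ F, G.IsNClique M f) ∧
    ∀ f ∈ F, ∀ g ∈ F, f ≠ g → B (avg e f) (avg e g) ≤ 35 / M}).exists_maximal ⟨∅, by simp⟩
  obtain ⟨hFc, hFo⟩ := hF.prop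
  refine ⟨F, fun v f ↦ 35 / M < B (e v) (avg e f), fun f hf g hg ↦ ?_, fun v f hf ↦ ?_,
    fun v ↦ ?_⟩
  · split_ifs with hfg
    · subst hfg
      rw [h.avg_self hM0 (hFc f hf), add_sub_cancel_left, abs_of_nonneg]
      · gcongr
        linarith [h.lt_rat]
      · exact div_nonneg (by linarith [h.two_le]) (by positivity)
    · rw [sub_zero, abs_of_nonneg (h.avg_avg_nonneg (hne (hFc f hf)) (hne (hFc g hg)))]
      exact hFo f hf g hg hfg
  · split_ifs with hvf
    · have h1 := h.vertex_avg_le hM0 (hFc f hf) v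
      have h2 := h.vertex_dichotomy hM (hFc f hf) v
      simp only [div_eq_mul_inv] at h1 h2 hvf ⊢
      rw [abs_le]
      constructor
      · rcases h2 with h2 | h2 <;> linarith
      · linarith
    · rw [sub_zero, abs_of_nonneg (h.vertex_avg_nonneg (hne (hFc f hf)) v)]
      exact not_lt.1 hvf
  · obtain ⟨Q, hQ, hv⟩ := hcov v
    have h1 := h.avg_mem hQ hv
    by_cases hQF : Q ∈ F
    · refine ⟨Q, hQF, ?_⟩
      simp only [h1, div_eq_mul_inv]
      nlinarith [h.two_le]
    · obtain ⟨f, hf, hQf⟩ : ∃ f ∈ F, 35 / M < B (avg e Q) (avg e f) := by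
        by_contra! hcon
        refine hQF (hF.le_of_ge ⟨?_, ?_⟩ (Finset.subset_insert Q F) (Finset.mem_insert_self Q F))
        · intro f hf
          obtain rfl | hf := Finset.mem_insert.1 hf
          exacts [hQ, hFc f hf]
        · intro f hf g hg hfg
          obtain rfl | hf' := Finset.mem_insert.1 hf <;>
            obtain rfl | hg' := Finset.mem_insert.1 hg
          · exact (hfg rfl).elim
          · exact hcon g hg'
          · rw [h.comm]
            exact hcon f hf'
          · exact hFo f hf' g hg' hfg
      refine ⟨f, hf, ?_⟩
      have h2 := (h.clique_dichotomy hM hQ (hFc f hf)).resolve_left (not_le.2 hQf)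
      have h3 := h.cauchy_schwarz (e v) (avg e Q - avg e f)
      simp only [map_sub, LinearMap.sub_apply] at h3
      rw [h1, h.avg_self hM0 hQ, h.avg_self hM0 (hFc f hf), h.comm (avg e f), h.gram,
        if_pos rfl] at h3
      by_contra hcon
      simp only [div_eq_mul_inv] at h2 h3 hcon
      generalize (M : ℝ)⁻¹ = t at *
      have h4 : (1 / 2 : ℝ) ≤ 1 + (L - 1) * t - B (e v) (avg e f) := by nlinarith [h.two_le]
      have h5 : (1 + (L - 1) * t - B (avg e Q) (avg e f) -
          (B (avg e Q) (avg e f) - (1 + (L - 1) * t))) ≤ 1 / 10 := by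
        nlinarith [h.two_le, h.lt_rat]
      nlinarith [h.two_le, h.lt_rat, mul_le_mul_of_nonneg_left h5 (by linarith [h.two_le] : 0 ≤ L)]

/-- Eliminating nearly orthonormal vectors `p f` from a positive semidefinite form. -/
lemma neg_le_sum_schur (B : LinearMap.BilinForm ℝ H) (hB : ∀ x, 0 ≤ B x x)
    (hcomm : ∀ x y, B x y = B y x) {ι : Type} {Φ : Finset ι} (hΦ : Φ.card ≤ 6) {p : ι → H}
    {δ : ℝ} (hδ : 0 ≤ δ)
    (hp : ∀ f ∈ Φ, ∀ g ∈ Φ, |B (p f) (p g) - if f = g then 1 else 0| ≤ δ)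
    (a : Fin 3 → H) (c : Fin 3 → ι → ℝ) (hc : ∀ i f, |c i f| ≤ 1)
    (hac : ∀ i, ∀ f ∈ Φ, |B (a i) (p f) - c i f| ≤ δ) (s : Fin 3 → ℝ) (hs : ∀ i, |s i| ≤ 2) :
    -(1728 * δ) ≤ ∑ i, ∑ j, s i * s j * (B (a i) (a j) - ∑ f ∈ Φ, c i f * c j f) := by
  set d : ι → ℝ := fun f ↦ ∑ i, s i * c i f with hd
  have hd6 (f) : |d f| ≤ 6 := by
    refine (Finset.abs_sum_le_sum_abs _ _).trans ?_
    calc ∑ i, |s i * c i f| ≤ ∑ i : Fin 3, (2 : ℝ) := by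
          refine Finset.sum_le_sum fun i _ ↦ ?_
          rw [abs_mul]
          nlinarith [hs i, hc i f, abs_nonneg (s i), abs_nonneg (c i f)]
      _ = 6 := by norm_num
  have key := hB (∑ i, s i • a i - ∑ f ∈ Φ, d f • p f)
  have expand : B (∑ i, s i • a i - ∑ f ∈ Φ, d f • p f) (∑ i, s i • a i - ∑ f ∈ Φ, d f • p f) =
      ∑ i, ∑ j, s i * s j * B (a i) (a j) - 2 * ∑ f ∈ Φ, d f * ∑ i, s i * B (a i) (p f) +
        ∑ f ∈ Φ, ∑ g ∈ Φ, d f * d g * B (p f) (p g) := by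
    have sq_sub (X Y : H) : B (X - Y) (X - Y) = B X X - 2 * B X Y + B Y Y := by
      simp only [map_sub, LinearMap.sub_apply, hcomm Y X]
      ring
    rw [sq_sub]
    simp only [map_sum, LinearMap.sum_apply, map_smul, LinearMap.smul_apply, smul_eq_mul]
    simp only [Finset.mul_sum]
    congr 1
    · congr 1
      rw [Finset.sum_comm]
      exact Finset.sum_congr rfl fun i _ ↦ Finset.sum_congr rfl fun j _ ↦ by ring
    · rw [Finset.sum_comm]
      exact Finset.sum_congr rfl fun f _ ↦ Finset.sum_congr rfl fun g _ ↦ by ring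
  have mixed : ∑ f ∈ Φ, d f ^ 2 - 216 * δ ≤ ∑ f ∈ Φ, d f * ∑ i, s i * B (a i) (p f) := by
    have h1 (f) (hf : f ∈ Φ) : d f ^ 2 - 36 * δ ≤ d f * ∑ i, s i * B (a i) (p f) := by
      have h2 : |d f - ∑ i, s i * B (a i) (p f)| ≤ 6 * δ := by
        rw [hd, ← Finset.sum_sub_distrib]
        refine (Finset.abs_sum_le_sum_abs _ _).trans ?_
        calc ∑ i, |s i * c i f - s i * B (a i) (p f)| ≤ ∑ i : Fin 3, 2 * δ := by
              refine Finset.sum_le_sum fun i _ ↦ ?_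
              rw [← mul_sub, abs_mul, abs_sub_comm]
              exact mul_le_mul (hs i) (hac i f hf) (abs_nonneg _) (by norm_num)
          _ = 6 * δ := by
              simp
              ring
      have h3 : |d f * (d f - ∑ i, s i * B (a i) (p f))| ≤ 6 * (6 * δ) := by
        rw [abs_mul]
        exact mul_le_mul (hd6 f) h2 (abs_nonneg _) (by norm_num)
      linarith [(abs_le.1 h3).2]
    have h2 := Finset.sum_le_sum h1
    rw [Finset.sum_sub_distrib, Finset.sum_const, nsmul_eq_mul] at h2
    have h3 : (Φ.card : ℝ) ≤ 6 := by exact_mod_cast hΦ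
    nlinarith
  have fat : ∑ f ∈ Φ, ∑ g ∈ Φ, d f * d g * B (p f) (p g) ≤ ∑ f ∈ Φ, d f ^ 2 + 1296 * δ := by
    have h1 (f) (hf : f ∈ Φ) : ∑ g ∈ Φ, d f * d g * B (p f) (p g) ≤ d f ^ 2 + 216 * δ := by
      have h2 (g) (hg : g ∈ Φ) :
          d f * d g * B (p f) (p g) ≤ (if f = g then d f * d g else 0) + 36 * δ := by
        have h3 : |d f * d g * (B (p f) (p g) - if f = g then 1 else 0)| ≤ 6 * 6 * δ := by
          rw [abs_mul, abs_mul]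
          exact mul_le_mul (mul_le_mul (hd6 f) (hd6 g) (abs_nonneg _) (by norm_num))
            (hp f hf g hg) (abs_nonneg _) (by norm_num)
        have h4 := (abs_le.1 h3).2
        split_ifs at h4 ⊢ <;> linarith
      have h3 := Finset.sum_le_sum h2
      rw [Finset.sum_add_distrib, Finset.sum_ite_eq, if_pos hf, Finset.sum_const,
        nsmul_eq_mul] at h3
      have h4 : (Φ.card : ℝ) ≤ 6 := by exact_mod_cast hΦ
      nlinarith
    have h2 := Finset.sum_le_sum h1
    rw [Finset.sum_add_distrib, Finset.sum_const, nsmul_eq_mul] at h2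
    have h3 : (Φ.card : ℝ) ≤ 6 := by exact_mod_cast hΦ
    nlinarith
  have split : ∑ i, ∑ j, s i * s j * (B (a i) (a j) - ∑ f ∈ Φ, c i f * c j f) =
      ∑ i, ∑ j, s i * s j * B (a i) (a j) - ∑ f ∈ Φ, d f ^ 2 := by
    simp only [mul_sub, Finset.sum_sub_distrib]
    congr 1
    simp only [hd, sq, Finset.sum_mul_sum]
    simp only [Finset.mul_sum]
    rw [Finset.sum_comm (s := Φ)]
    refine Finset.sum_congr rfl fun i _ ↦ ?_
    rw [Finset.sum_comm (s := Φ)]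
    refine Finset.sum_congr rfl fun j _ ↦ Finset.sum_congr rfl fun f _ ↦ by ring
  rw [split]
  rw [expand] at key
  linarith

end IsGramRep

/-- A symmetric matrix whose entries are `0` or have square `1`, and whose support is transitive
with positive triangles, is positive semidefinite. -/
lemma quadratic_nonneg_of_mul_eq {V : Type} [Fintype V] (P : V → V → ℝ)
    (hsymm : ∀ u v, P u v = P v u) (hP : ∀ u v, P u v = 0 ∨ P u v ^ 2 = 1)
    (hmul : ∀ u v w, P u v * P v w = P u w * P v w ^ 2) (x : V → ℝ) :
    0 ≤ ∑ u, ∑ w, x u * x w * P u w := by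
  set n : V → ℝ := fun v ↦ ∑ z, P v z ^ 2 with hn
  have hn0 (v) : 0 ≤ n v := Finset.sum_nonneg fun _ _ ↦ sq_nonneg _
  have hnn {v w} (h : P v w ≠ 0) : n v = n w := by
    refine Finset.sum_congr rfl fun z _ ↦ ?_
    have h1 := (hP v w).resolve_left h
    have h2 := hmul z v w
    rw [hsymm v z, hsymm w z]
    calc P z v ^ 2 = P z v ^ 2 * P v w ^ 2 := by rw [h1, mul_one]
      _ = (P z v * P v w) ^ 2 := by ring
      _ = P z w ^ 2 := by rw [h2, h1, mul_one]
  have hrow (u w) : P u w = ∑ v, (n v)⁻¹ * (P u v * P v w) := by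
    have h1 (v) : (n v)⁻¹ * (P u v * P v w) = P u w * ((n w)⁻¹ * P w v ^ 2) := by
      rw [hmul, hsymm w v]
      by_cases h : P v w = 0
      · simp [h]
      · rw [hnn h]
        ring
    simp only [h1]
    rw [← Finset.mul_sum, ← Finset.mul_sum]
    by_cases h : P u w = 0
    · simp [h]
    · have : 1 ≤ n w := by
        rw [← (hP u w).resolve_left h, hsymm u w]
        exact Finset.single_le_sum (f := fun z ↦ P w z ^ 2) (fun _ _ ↦ sq_nonneg _)
          (Finset.mem_univ u)
      rw [inv_mul_cancel₀ (by positivity), mul_one]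
  calc 0 ≤ ∑ v, (n v)⁻¹ * (∑ u, x u * P u v) ^ 2 :=
        Finset.sum_nonneg fun v _ ↦ mul_nonneg (inv_nonneg.2 (hn0 v)) (sq_nonneg _)
    _ = ∑ u, ∑ w, x u * x w * P u w := by
        simp only [sq, Finset.sum_mul_sum]
        simp only [Finset.mul_sum]
        rw [Finset.sum_comm]
        refine Finset.sum_congr rfl fun u _ ↦ ?_
        rw [Finset.sum_comm]
        refine Finset.sum_congr rfl fun w _ ↦ ?_
        conv_rhs => rw [hrow u w, Finset.mul_sum]
        refine Finset.sum_congr rfl fun v _ ↦ ?_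
        rw [hsymm w v]
        ring

/-- The entries of `A(G) + 2 • 1 - C * Cᵀ`, where `C` is the incidence relation between vertices and
the members of `F`. -/
noncomputable def reducedEntry {V ι : Type} (G : SimpleGraph V) (F : Finset ι) (C : V → ι → Prop)
    (u v : V) : ℤ :=
  (if u = v then 2 else if G.Adj u v then 1 else 0) - (F.filter fun f ↦ C u f ∧ C v f).card

lemma reducedEntry_comm {V ι : Type} (G : SimpleGraph V) (F : Finset ι) (C : V → ι → Prop)
    (u v : V) : reducedEntry G F C u v = reducedEntry G F C v u := by
  simp only [reducedEntry, eq_comm (a := u), G.adj_comm u, and_comm (a := C u _)]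

namespace IsGramRep

variable {V H ι : Type} [AddCommGroup H] [Module ℝ H] {G : SimpleGraph V} {L : ℝ}
  {B : LinearMap.BilinForm ℝ H} {e : V → H} {F : Finset ι} {p : ι → H} {C : V → ι → Prop} {δ : ℝ}

lemma card_filter_le_two (h : IsGramRep G L B e) (hδ : 0 ≤ δ) (hδ' : 1728 * δ ≤ 1 / 10)
    (hp : ∀ f ∈ F, ∀ g ∈ F, |B (p f) (p g) - if f = g then 1 else 0| ≤ δ)
    (hC : ∀ v, ∀ f ∈ F, |B (e v) (p f) - if C v f then 1 else 0| ≤ δ) (v : V) :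
    (F.filter (C v)).card ≤ 2 := by
  by_contra! hcard
  obtain ⟨Φ, hΦ, hΦc⟩ := Finset.exists_subset_card_eq (show 3 ≤ (F.filter (C v)).card from hcard)
  have hΦF {f} (hf : f ∈ Φ) : f ∈ F := (Finset.mem_filter.1 (hΦ hf)).1
  have h1 := neg_le_sum_schur B h.nonneg h.comm (Φ := Φ) (by omega) hδ
    (fun f hf g hg ↦ hp f (hΦF hf) g (hΦF hg)) (fun _ ↦ e v) (fun _ f ↦ if C v f then 1 else 0)
    (fun _ f ↦ by split_ifs <;> simp) (fun _ f hf ↦ hC v f (hΦF hf)) ![1, 0, 0]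
    (by simp [Fin.forall_fin_succ])
  have h2 : ∑ f ∈ Φ, (if C v f then (1 : ℝ) else 0) * (if C v f then 1 else 0) = 3 := by
    rw [Finset.sum_congr rfl (g := fun _ ↦ (1 : ℝ))]
    · simp [hΦc]
    · intro f hf
      simp [(Finset.mem_filter.1 (hΦ hf)).2]
  simp only [h2, h.gram, if_true, Fin.sum_univ_three] at h1
  simp at h1
  linarith [h.lt_rat]

lemma neg_le_sum_reducedEntry (h : IsGramRep G L B e) (hδ : 0 ≤ δ) (hδ' : 1728 * δ ≤ 1 / 10)
    (hp : ∀ f ∈ F, ∀ g ∈ F, |B (p f) (p g) - if f = g then 1 else 0| ≤ δ)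
    (hC : ∀ v, ∀ f ∈ F, |B (e v) (p f) - if C v f then 1 else 0| ≤ δ)
    (u : Fin 3 → V) (s : Fin 3 → ℝ) (hs : ∀ i, |s i| ≤ 2) :
    -(1728 * δ) ≤ ∑ i, ∑ j, s i * s j *
      (reducedEntry G F C (u i) (u j) + if u i = u j then L - 2 else 0) := by
  set Φ := F.filter fun f ↦ ∃ i, C (u i) f with hΦ
  have hΦF {f} (hf : f ∈ Φ) : f ∈ F := (Finset.mem_filter.1 hf).1
  have hcard : Φ.card ≤ 6 := by
    calc Φ.card ≤ (Finset.univ.biUnion fun i ↦ F.filter (C (u i))).card := by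
          refine Finset.card_le_card fun f hf ↦ ?_
          simpa [hΦ] using hf
      _ ≤ (Finset.univ : Finset (Fin 3)).card * 2 :=
          Finset.card_biUnion_le_card_mul _ _ _ fun i _ ↦ h.card_filter_le_two hδ hδ' hp hC (u i)
      _ = 6 := rfl
  have h1 := neg_le_sum_schur B h.nonneg h.comm (Φ := Φ) hcard hδ
    (fun f hf g hg ↦ hp f (hΦF hf) g (hΦF hg)) (fun i ↦ e (u i))
    (fun i f ↦ if C (u i) f then 1 else 0)
    (fun _ f ↦ by split_ifs <;> simp) (fun i f hf ↦ hC (u i) f (hΦF hf)) s hs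
  refine h1.trans_eq (Finset.sum_congr rfl fun i _ ↦ Finset.sum_congr rfl fun j _ ↦ ?_)
  have h2 : ∑ f ∈ Φ, (if C (u i) f then (1 : ℝ) else 0) * (if C (u j) f then 1 else 0) =
      (F.filter fun f ↦ C (u i) f ∧ C (u j) f).card := by
    simp only [← ite_and, ite_mul, one_mul, zero_mul]
    rw [← Finset.sum_filter, Finset.sum_const, nsmul_one, hΦ, Finset.filter_filter]
    congr 2
    exact Finset.filter_congr fun f _ ↦ by grind
  rw [h2, h.gram, reducedEntry]
  congr 1
  push_cast
  split_ifs <;> ring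

/-- The smallest eigenvalue is at least `-2` as soon as there is a nearly orthonormal family such
that every vertex is nearly fully or nearly not joined to each member, and joined to at least one. -/
lemma neg_two_mul_le (h : IsGramRep G L B e) [Fintype V] (hδ : 0 ≤ δ) (hδ' : 1728 * δ ≤ 1 / 10)
    (hδL : 1728 * δ < 4 * (1 + √2 - L))
    (hp : ∀ f ∈ F, ∀ g ∈ F, |B (p f) (p g) - if f = g then 1 else 0| ≤ δ)
    (hC : ∀ v, ∀ f ∈ F, |B (e v) (p f) - if C v f then 1 else 0| ≤ δ)
    (hcov : ∀ v, ∃ f ∈ F, C v f) (x : V → ℝ) :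
    -2 * ∑ u, x u ^ 2 ≤ ∑ u, ∑ v, if G.Adj u v then x u * x v else 0 := by
  set P := reducedEntry G F C with hPdef
  have hsymm (u v) : P u v = P v u := reducedEntry_comm G F C u v
  have hdiag (v) : P v v = 0 ∨ P v v = 1 := by
    have h1 := h.card_filter_le_two hδ hδ' hp hC v
    obtain ⟨f, hf, hvf⟩ := hcov v
    have h2 : 0 < (F.filter (C v)).card := Finset.card_pos.2 ⟨f, Finset.mem_filter.2 ⟨hf, hvf⟩⟩
    have h3 : (F.filter fun f ↦ C v f ∧ C v f).card = (F.filter (C v)).card := by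
      congr 1
      exact Finset.filter_congr fun f _ ↦ and_self_iff
    simp only [hPdef, reducedEntry, if_true, h3]
    omega
  have hdiag' (v) : (P v v : ℝ) ≤ 1 := by
    rcases hdiag v with h1 | h1 <;> simp [h1]
  have three {u v w : V} (huv : u ≠ v) (huw : u ≠ w) (hvw : v ≠ w) (a b c : ℝ) (ha : |a| ≤ 2)
      (hb : |b| ≤ 2) (hc : |c| ≤ 2) : -(1728 * δ) ≤ a ^ 2 * (L - 1) + b ^ 2 * (L - 1) +
        c ^ 2 * (L - 1) + 2 * (a * b * P u v + a * c * P u w + b * c * P v w) := by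
    have h1 := h.neg_le_sum_reducedEntry hδ hδ' hp hC ![u, v, w] ![a, b, c]
      (by simp [Fin.forall_fin_succ, ha, hb, hc])
    simp only [Fin.sum_univ_three] at h1
    simp [huv, huw, hvw, huv.symm, huw.symm, hvw.symm, ← hPdef, hsymm v u, hsymm w u,
      hsymm w v] at h1
    nlinarith [mul_nonneg (sq_nonneg a) (sub_nonneg.2 (hdiag' u)),
      mul_nonneg (sq_nonneg b) (sub_nonneg.2 (hdiag' v)),
      mul_nonneg (sq_nonneg c) (sub_nonneg.2 (hdiag' w))]
  have two {u v : V} (huv : u ≠ v) (b : ℝ) (hb : |b| ≤ 2) : -(1728 * δ) ≤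
      (P u u + (L - 2)) + b ^ 2 * (L - 1) + 2 * (b * P u v) := by
    have h1 := h.neg_le_sum_reducedEntry hδ hδ' hp hC ![u, v, u] ![1, b, 0]
      (by simp [Fin.forall_fin_succ, hb])
    simp only [Fin.sum_univ_three] at h1
    simp [huv, huv.symm, ← hPdef, hsymm v u] at h1
    nlinarith [mul_nonneg (sq_nonneg b) (sub_nonneg.2 (hdiag' v))]
  have hoff {u v : V} (huv : u ≠ v) (h0 : P u v ≠ 0) :
      P u u = 1 ∧ (P u v = 1 ∨ P u v = -1) := by
    have h1 := two huv 1 (by norm_num)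
    have h2 := two huv (-1) (by norm_num)
    have h3 := h.lt_rat
    have h4 : (P u u : ℝ) - 2 * |(P u v : ℝ)| > -2 := by
      rcases abs_cases (P u v : ℝ) with h5 | h5 <;> linarith
    have h5 : P u u - 2 * |P u v| > -2 := by exact_mod_cast h4
    rcases hdiag u with h6 | h6 <;> rcases abs_cases (P u v) with h7 | h7 <;> omega
  have hsq {u v : V} (huv : u ≠ v) (h0 : P u v ≠ 0) : (P u v : ℝ) * P u v = 1 := by
    rcases (hoff huv h0).2 with h1 | h1 <;> simp [h1]
  have habs {u v : V} (huv : u ≠ v) (h0 : P u v ≠ 0) : |-(P u v : ℝ)| ≤ 2 := by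
    rcases (hoff huv h0).2 with h1 | h1 <;> simp [h1]
  have hpath {u v w : V} (huv : u ≠ v) (huw : u ≠ w) (hvw : v ≠ w) (h1 : P u v ≠ 0)
      (h2 : P v w ≠ 0) : P u w ≠ 0 := by
    intro h3
    have h4 := three huv huw hvw (-P u v) √2 (-P v w) (habs huv h1)
      (by
        rw [abs_of_nonneg (Real.sqrt_nonneg 2)]
        exact Real.sqrt_le_iff.2 (by norm_num))
      (habs hvw h2)
    rw [h3, Real.sq_sqrt (by norm_num)] at h4
    have h5 := hsq huv h1
    have h6 := hsq hvw h2
    have h7 : (-(P u v : ℝ)) ^ 2 * (L - 1) + 2 * (L - 1) + (-(P v w : ℝ)) ^ 2 * (L - 1) +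
        2 * (-(P u v : ℝ) * √2 * P u v + -(P u v : ℝ) * -(P v w : ℝ) * (0 : ℤ) +
          √2 * -(P v w : ℝ) * P v w) = 4 * (L - 1 - √2) := by
      push_cast
      linear_combination (L - 1 - 2 * √2) * h5 + (L - 1 - 2 * √2) * h6
    rw [h7] at h4
    linarith
  have htri {u v w : V} (huv : u ≠ v) (huw : u ≠ w) (hvw : v ≠ w) (h1 : P u v ≠ 0)
      (h2 : P v w ≠ 0) (h3 : P u w ≠ 0) : P u v * P v w = P u w := by
    by_contra hne
    have h4 : P u v * P u w * P v w = -1 := by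
      rcases (hoff huv h1).2 with h5 | h5 <;> rcases (hoff hvw h2).2 with h6 | h6 <;>
        rcases (hoff huw h3).2 with h7 | h7 <;> simp_all
    have h4' : (P u v : ℝ) * P u w * P v w = -1 := by exact_mod_cast h4
    have h5 := three huv huw hvw 1 (-P u v) (-P u w) (by norm_num) (habs huv h1) (habs huw h3)
    have h6 := hsq huv h1
    have h7 := hsq huw h3
    have h8 : (1 : ℝ) ^ 2 * (L - 1) + (-(P u v : ℝ)) ^ 2 * (L - 1) + (-(P u w : ℝ)) ^ 2 * (L - 1) +
        2 * (1 * -(P u v : ℝ) * P u v + 1 * -(P u w : ℝ) * P u w +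
          -(P u v : ℝ) * -(P u w : ℝ) * P v w) = 3 * (L - 3) := by
      linear_combination (L - 3) * h6 + (L - 3) * h7 + 2 * h4'
    rw [h8] at h5
    linarith [h.lt_rat]
  have hunit (u v) : P u v = 0 ∨ P u v ^ 2 = 1 := by
    by_cases huv : u = v
    · subst huv
      exact (hdiag u).imp_right fun h1 ↦ by rw [h1, one_pow]
    · by_cases h0 : P u v = 0
      · exact .inl h0
      · rcases (hoff huv h0).2 with h1 | h1 <;> simp [h1]
  have hmul (u v w) : P u v * P v w = P u w * P v w ^ 2 := by
    by_cases hvw : v = w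
    · subst hvw
      rcases hdiag v with h1 | h1 <;> simp [h1]
    by_cases h1 : P v w = 0
    · simp [h1]
    rw [(hunit v w).resolve_left h1, mul_one]
    by_cases huv : u = v
    · subst huv
      rw [(hoff hvw h1).1, one_mul]
    by_cases huw : u = w
    · subst huw
      rw [hsymm u v, ← sq, (hunit v u).resolve_left h1, (hoff huv (hsymm v u ▸ h1)).1]
    by_cases h2 : P u v = 0
    · by_cases h3 : P u w = 0
      · rw [h2, h3, zero_mul]
      · exact (hpath huw huv (Ne.symm hvw) h3 (hsymm v w ▸ h1) h2).elim
    · exact htri huv huw hvw h2 h1 (hpath huv huw hvw h2 h1)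
  have hP := quadratic_nonneg_of_mul_eq (fun u v ↦ (P u v : ℝ))
    (fun u v ↦ by simp only [hsymm u v])
    (fun u v ↦ by exact_mod_cast hunit u v) (fun u v w ↦ by exact_mod_cast hmul u v w) x
  have hCC : ∑ u, ∑ v, x u * x v * ((F.filter fun f ↦ C u f ∧ C v f).card : ℝ) =
      ∑ f ∈ F, (∑ u, if C u f then x u else 0) ^ 2 := by
    have h1 (u v) : x u * x v * ((F.filter fun f ↦ C u f ∧ C v f).card : ℝ) =
        ∑ f ∈ F, (if C u f then x u else 0) * (if C v f then x v else 0) := by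
      rw [Finset.card_filter, Nat.cast_sum, Finset.mul_sum]
      refine Finset.sum_congr rfl fun f _ ↦ ?_
      by_cases h2 : C u f <;> by_cases h3 : C v f <;> simp [h2, h3]
    simp only [h1, sq, Finset.sum_mul_sum]
    rw [Finset.sum_comm (s := F)]
    exact Finset.sum_congr rfl fun u _ ↦ Finset.sum_comm
  have hCC0 : 0 ≤ ∑ f ∈ F, (∑ u, if C u f then x u else 0) ^ 2 :=
    Finset.sum_nonneg fun _ _ ↦ sq_nonneg _
  have hsplit : ∑ u, ∑ v, x u * x v * (P u v : ℝ) = 2 * ∑ u, x u ^ 2 +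
      (∑ u, ∑ v, if G.Adj u v then x u * x v else 0) -
      ∑ u, ∑ v, x u * x v * ((F.filter fun f ↦ C u f ∧ C v f).card : ℝ) := by
    have h1 (u v) : x u * x v * (P u v : ℝ) = (if u = v then 2 * (x u * x v) else 0) +
        (if G.Adj u v then x u * x v else 0) -
        x u * x v * ((F.filter fun f ↦ C u f ∧ C v f).card : ℝ) := by
      simp only [hPdef, reducedEntry]
      push_cast
      by_cases huv : u = v
      · subst huv
        simp
        ring
      · by_cases hadj : G.Adj u v <;> simp [huv, hadj] <;> ring
    simp only [h1, Finset.sum_add_distrib, Finset.sum_sub_distrib]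
    simp [sq, Finset.mul_sum]
  linarith

end IsGramRep

lemma isGramRep_toBilin' {V : Type} [Fintype V] [Nonempty V] {G : SimpleGraph V}
    (h2 : lambdaMin G ≤ -2) (h : -1 - √2 < lambdaMin G) :
    IsGramRep G (-lambdaMin G)
      (Matrix.toBilin' (G.adjMatrix ℝ + (-lambdaMin G) • (1 : Matrix V V ℝ)))
      (fun v ↦ Pi.single v 1) where
  nonneg x := by
    have h1 := (le_lambdaMin_iff G _).1 le_rfl x
    have h3 : Matrix.toBilin' (G.adjMatrix ℝ + (-lambdaMin G) • (1 : Matrix V V ℝ)) x x =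
        (∑ u, ∑ v, if G.Adj u v then x u * x v else 0) - lambdaMin G * ∑ u, x u ^ 2 := by
      simp only [Matrix.toBilin'_apply, Matrix.add_apply, Matrix.smul_apply, mul_add, add_mul,
        Finset.sum_add_distrib, Matrix.one_apply]
      rw [sub_eq_add_neg]
      congr 1
      · simp
      · simp [Finset.mul_sum, sq, mul_left_comm, mul_assoc]
    rw [h3]
    linarith
  comm x y := by
    simp only [Matrix.toBilin'_apply]
    rw [Finset.sum_comm]
    refine Finset.sum_congr rfl fun u _ ↦ Finset.sum_congr rfl fun v _ ↦ ?_
    simp only [Matrix.add_apply, Matrix.smul_apply, Matrix.one_apply, adjMatrix_apply,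
      G.adj_comm u v, eq_comm (a := u)]
    ring
  gram u v := by
    rw [Matrix.toBilin'_single]
    by_cases huv : u = v
    · subst huv
      simp
    · simp [huv]
  two_le := by linarith
  lt := by linarith

/-- **Hoffman's theorem**: for graphs of large minimum degree there is no smallest eigenvalue
strictly between `-1 - √2 + ε` and `-2`. -/
lemma exists_minDegree_neg_two_le {ε : ℝ} (hε : 0 < ε) :
    ∃ K : ℕ, ∀ {V : Type} [Fintype V] [Nonempty V] (G : SimpleGraph V),
      (∀ v, K ≤ G.degree v) → -1 - √2 + ε ≤ lambdaMin G → -2 ≤ lambdaMin G := by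
  obtain ⟨m, hm⟩ := exists_nat_gt (max 1000 (1728 * 35 / min (4 * ε) (1 / 10)))
  obtain ⟨hm1, hm2⟩ := max_lt_iff.1 hm
  have hm1' : 1000 < m := by exact_mod_cast hm1
  obtain ⟨K, hK⟩ := exists_ramsey m 6
  refine ⟨K, fun {V} _ _ G hdeg hG ↦ ?_⟩
  by_contra! hlt
  have h := isGramRep_toBilin' hlt.le (by linarith)
  have hcov (v : V) : ∃ Q, G.IsNClique (m + 1) Q ∧ v ∈ Q := by
    obtain ⟨Q, hQ, hc⟩ | ⟨I, hI, hc⟩ := hK G (G.neighborFinset v) (hdeg v)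
    · exact ⟨insert v Q, hc.insert fun w hw ↦ (G.mem_neighborFinset v w).1 (hQ hw),
        Finset.mem_insert_self v Q⟩
    · exact (h.no_independent_six hc fun w hw ↦ (G.mem_neighborFinset v w).1 (hI hw)).elim
  obtain ⟨F, C, hp, hC, hF⟩ := h.exists_clique_family (by omega) hcov
  have hmin : 0 < min (4 * ε) (1 / 10) := by positivity
  have hδ : 1728 * (35 / ((m + 1 : ℕ) : ℝ)) < min (4 * ε) (1 / 10) := by
    rw [div_lt_iff₀ hmin] at hm2
    rw [← mul_div_assoc, div_lt_iff₀ (by positivity)]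
    push_cast
    linarith
  obtain ⟨hδ1, hδ2⟩ := lt_min_iff.1 hδ
  have := (le_lambdaMin_iff G (-2)).2
    (h.neg_two_mul_le (by positivity) hδ2.le (by linarith)
      (fun f hf g hg ↦ by convert hp f hf g hg) hC hF)
  linarith

/-- `θ̂_k`, the supremum of `λmin` over connected graphs with minimum degree at least `k` and
`λmin < -2`, is nonincreasing in `k` (for `k ≥ 1`) and tends to `-1-√2` as `k → ∞`. -/
theorem stmt_5 :
    (∀ j k : ℕ, 1 ≤ j → j ≤ k →
      sSup {x : ℝ | ∃ (n : ℕ) (G : SimpleGraph (Fin n)), G.Connected ∧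
          (∀ v : Fin n, k ≤ G.degree v) ∧ lambdaMin G < -2 ∧ lambdaMin G = x} ≤
      sSup {x : ℝ | ∃ (n : ℕ) (G : SimpleGraph (Fin n)), G.Connected ∧
          (∀ v : Fin n, j ≤ G.degree v) ∧ lambdaMin G < -2 ∧ lambdaMin G = x}) ∧
    Tendsto (fun k : ℕ =>
        sSup {x : ℝ | ∃ (n : ℕ) (G : SimpleGraph (Fin n)), G.Connected ∧
          (∀ v : Fin n, k ≤ G.degree v) ∧ lambdaMin G < -2 ∧ lambdaMin G = x})
      atTop (nhds (-1 - Real.sqrt 2)) := by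
  set S : ℕ → Set ℝ := fun k ↦ {x : ℝ | ∃ (n : ℕ) (G : SimpleGraph (Fin n)), G.Connected ∧
    (∀ v : Fin n, k ≤ G.degree v) ∧ lambdaMin G < -2 ∧ lambdaMin G = x} with hS
  have hbdd (k) : BddAbove (S k) := ⟨-2, by
    rintro _ ⟨n, G, _, _, h, rfl⟩
    exact h.le⟩
  have hmem (k) : ∃ x ∈ S k, -1 - √2 ≤ x := by
    obtain ⟨n, G, h1, h2, h3, h4⟩ := exists_connected_lambdaMin_lt k
    exact ⟨_, ⟨n, G, h1, h2, h3, rfl⟩, h4⟩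
  have hlow (k) : -1 - √2 ≤ sSup (S k) := by
    obtain ⟨x, hx, hle⟩ := hmem k
    exact hle.trans (le_csSup (hbdd k) hx)
  refine ⟨fun j k _ hjk ↦ csSup_le_csSup (hbdd j) ((hmem k).imp fun _ h ↦ h.1) ?_, ?_⟩
  · rintro x ⟨n, G, h1, h2, h3, h4⟩
    exact ⟨n, G, h1, fun v ↦ hjk.trans (h2 v), h3, h4⟩
  · refine Metric.tendsto_atTop.2 fun ε hε ↦ ?_
    obtain ⟨K, hK⟩ := exists_minDegree_neg_two_le (half_pos hε)
    refine ⟨K, fun k hk ↦ ?_⟩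
    have hup : sSup (S k) ≤ -1 - √2 + ε / 2 := by
      refine csSup_le ((hmem k).imp fun _ h ↦ h.1) ?_
      rintro _ ⟨n, G, h1, h2, h3, rfl⟩
      by_contra! hlt
      have := h1.nonempty
      exact h3.not_ge (hK G (fun v ↦ hk.trans (by convert h2 v)) hlt.le)
    rw [Real.dist_eq, abs_of_nonneg (sub_nonneg.2 (hlow k))]
    linarith
end
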